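/- For every positive integer m there exists an integer D(m) with the following property: for all integers d ≥ D(m), all r ≥ 1 and all multiplicities m_1, …, m_r with 1 ≤ m_i ≤ m, there is a dense Zariski-open subset U of (ℙ²(ℂ))^r such that for every r-tuple (P_1, …, P_r) ∈ U of (pairwise distinct) points, the complex vector space L_d(P, m) of homogeneous polynomials of degree d in ℂ[X,Y,Z] vanishing to order at least m_i at P_i for each i has dimension exactly max(0, (d+1)(d+2)/2 − Σ_{i=1}^r m_i(m_i+1)/2). -/

import Mathlib

open MvPolynomial

noncomputable section

abbrev Proj2 := Projectivization ℂ (Fin 3 → ℂ)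

/-- The iterated partial derivative operator `∂₀^{k 0} ∂₁^{k 1} ∂₂^{k 2}`. -/
def diffOp (k : Fin 3 → ℕ) : MvPolynomial (Fin 3) ℂ →ₗ[ℂ] MvPolynomial (Fin 3) ℂ :=
  (((pderiv (0 : Fin 3)).toLinearMap ^ k 0) * ((pderiv (1 : Fin 3)).toLinearMap ^ k 1) *
    ((pderiv (2 : Fin 3)).toLinearMap ^ k 2) :
    Module.End ℂ (MvPolynomial (Fin 3) ℂ))

/-- Polynomials all of whose partial derivatives of total order `< m` vanish at `p`. -/
def vanishingSubmodule (m : ℕ) (p : Fin 3 → ℂ) : Submodule ℂ (MvPolynomial (Fin 3) ℂ) :=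
  ⨅ k ∈ {k : Fin 3 → ℕ | k 0 + k 1 + k 2 < m},
    LinearMap.ker ((aeval p).toLinearMap ∘ₗ diffOp k)

/-- The space of homogeneous polynomials of degree `d` vanishing to order at least `mi i`
at the point `P i`, for each `i`. -/
def Lspace (d : ℕ) {r : ℕ} (P : Fin r → Proj2) (mi : Fin r → ℕ) :
    Submodule ℂ (MvPolynomial (Fin 3) ℂ) :=
  homogeneousSubmodule (Fin 3) ℂ d ⊓ ⨅ i, vanishingSubmodule (mi i) (P i).rep

/-- The Zariski topology on a complex vector space: generated by the nonvanishing loci of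
polynomial functions (polynomials in finitely many linear forms). -/
def vectorZariski (V : Type*) [AddCommGroup V] [Module ℂ V] : TopologicalSpace V :=
  TopologicalSpace.generateFrom
    { U | ∃ (n : ℕ) (f : MvPolynomial (Fin n) ℂ) (φ : Fin n → (V →ₗ[ℂ] ℂ)),
        U = {v | MvPolynomial.eval (fun i => φ i v) f ≠ 0} }

/-- The Zariski topology on the space of `r`-tuples of points of `ℙ²(ℂ)`, obtained as the
quotient topology from the Zariski topology on tuples of nonzero vectors in `ℂ³`. -/
def projTupleZariski (r : ℕ) : TopologicalSpace (Fin r → Proj2) :=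
  TopologicalSpace.coinduced
    (fun v : {v : Fin r → Fin 3 → ℂ // ∀ i, v i ≠ 0} =>
      fun i => Projectivization.mk ℂ (v.1 i) (v.2 i))
    (TopologicalSpace.induced Subtype.val (vectorZariski (Fin r → Fin 3 → ℂ)))

/-- The Zariski topology on the projectivization of a complex vector space. -/
def projZariski (V : Type*) [AddCommGroup V] [Module ℂ V] :
    TopologicalSpace (Projectivization ℂ V) :=
  TopologicalSpace.coinduced
    (fun v : {v : V // v ≠ 0} => Projectivization.mk ℂ v.1 v.2)
    (TopologicalSpace.induced Subtype.val (vectorZariski V))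

/-- The dehomogenization of `F` in the affine chart `(x, y) ↦ A ⬝ (x, y, 1)`. -/
def chartPoly (A : Matrix (Fin 3) (Fin 3) ℂ) (F : MvPolynomial (Fin 3) ℂ) :
    MvPolynomial (Fin 2) ℂ :=
  aeval (fun j : Fin 3 => ∑ i : Fin 3, C (A j i) * ![X 0, X 1, (1 : MvPolynomial (Fin 2) ℂ)] i) F

/-- `F` has an ordinary singularity of multiplicity `m` at `P`: in some affine chart centered
at `P`, the lowest-degree homogeneous part of the dehomogenization of `F` has degree exactly
`m` and is a squarefree binary form. -/
def HasOrdinarySingularity (m : ℕ) (P : Proj2) (F : MvPolynomial (Fin 3) ℂ) : Prop :=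
  ∃ A : Matrix (Fin 3) (Fin 3) ℂ, IsUnit A.det ∧
    ∃ h : A.mulVec ![0, 0, 1] ≠ 0,
      Projectivization.mk ℂ (A.mulVec ![0, 0, 1]) h = P ∧
      (∀ k < m, homogeneousComponent k (chartPoly A F) = 0) ∧
      homogeneousComponent m (chartPoly A F) ≠ 0 ∧
      Squarefree (homogeneousComponent m (chartPoly A F))

/-- The curve `{F = 0}` is smooth away from the points `P i`: at every point of the curve
other than the `P i`, some first partial derivative of `F` is nonzero. -/
def SmoothAwayFrom {r : ℕ} (F : MvPolynomial (Fin 3) ℂ) (P : Fin r → Proj2) : Prop :=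
  ∀ Q : Proj2, eval Q.rep F = 0 → (∀ i, Q ≠ P i) →
    ∃ j : Fin 3, eval Q.rep (pderiv j F) ≠ 0

/-- The logarithmic jet of order `< P.2` at the torus point `P.1` of the polynomial
`∑ e ∈ D, a e X ^ e.1 Y ^ e.2` vanishes. -/
def LogVanish (D : Finset (ℕ × ℕ)) (a : ℕ × ℕ → ℂ) (P : (ℂˣ × ℂˣ) × ℕ) : Prop :=
  ∀ i j, i + j < P.2 →
    ∑ e ∈ D, a e * ((e.1 : ℂ) ^ i * (e.2 : ℂ) ^ j * ((P.1.1 : ℂ) ^ e.1 * (P.1.2 : ℂ) ^ e.2)) = 0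

/-- For some choice of points, no nonzero polynomial with monomials in `D` has multiplicities
at least `ms` at these points. -/
def NonSpecial (D : Finset (ℕ × ℕ)) (ms : Multiset ℕ) : Prop :=
  ∃ Q : Multiset ((ℂˣ × ℂˣ) × ℕ), Q.map Prod.snd = ms ∧
    ∀ a : ℕ × ℕ → ℂ, (∀ P ∈ Q, LogVanish D a P) → ∀ e ∈ D, a e = 0

theorem nonSpecial_empty (ms : Multiset ℕ) : NonSpecial ∅ ms :=
  ⟨ms.map fun k => ((1, 1), k), by simp, by simp⟩

theorem NonSpecial.mono {D D' : Finset (ℕ × ℕ)} {ms : Multiset ℕ} (h : NonSpecial D' ms)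
    (hD : D ⊆ D') : NonSpecial D ms := by
  classical
  obtain ⟨Q, hQ, hinj⟩ := h
  refine ⟨Q, hQ, fun a ha e he => ?_⟩
  have := hinj (fun e => if e ∈ D then a e else 0) (fun P hP i j hij => ?_) e (hD he)
  · simpa [he] using this
  · simp only [ite_mul, zero_mul]
    rw [← Finset.sum_filter, Finset.filter_mem_eq_inter, Finset.inter_eq_right.mpr hD]
    exact ha P hP i j hij

theorem NonSpecial.mono_right {D : Finset (ℕ × ℕ)} {ms ms' : Multiset ℕ} (h : NonSpecial D ms)
    (hms : ms ≤ ms') : NonSpecial D ms' := by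
  obtain ⟨Q, hQ, hinj⟩ := h
  obtain ⟨u, rfl⟩ := Multiset.le_iff_exists_add.mp hms
  refine ⟨Q + u.map fun k => ((1, 1), k), by simp [hQ], fun a ha => hinj a fun P hP => ?_⟩
  exact ha P (Multiset.mem_add.mpr (Or.inl hP))

theorem NonSpecial.swap {D : Finset (ℕ × ℕ)} {ms : Multiset ℕ} (h : NonSpecial D ms) :
    NonSpecial (D.image Prod.swap) ms := by
  obtain ⟨Q, hQ, hinj⟩ := h
  refine ⟨Q.map fun P => (P.1.swap, P.2), by simpa [Multiset.map_map] using hQ, fun a ha e he => ?_⟩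
  obtain ⟨f, hf, rfl⟩ := Finset.mem_image.mp he
  refine hinj (fun e => a e.swap) (fun P hP i j hij => ?_) f hf
  have := ha (P.1.swap, P.2) (Multiset.mem_map_of_mem _ hP) j i (by simpa [add_comm] using hij)
  rw [Finset.sum_image Prod.swap_injective.injOn] at this
  rw [← this]
  refine Finset.sum_congr rfl fun e _ => ?_
  simp only [Prod.fst_swap, Prod.snd_swap]
  ring

/-- The vanishing conditions at finitely many points as a linear system with finitely many
equations, independent of the set of monomials. -/
theorem exists_conditionVector (Q : Multiset ((ℂˣ × ℂˣ) × ℕ)) :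
    ∃ (ι : Type) (_ : Finite ι) (c : ℕ × ℕ → ι → ℂ), ∀ (D : Finset (ℕ × ℕ)) (a : ℕ × ℕ → ℂ),
      (∀ P ∈ Q, LogVanish D a P) ↔ ∑ e ∈ D, a e • c e = 0 := by
  classical
  let S := Q.toFinset.sigma fun P => (Finset.range P.2 ×ˢ Finset.range P.2).filter
    fun ij => ij.1 + ij.2 < P.2
  refine ⟨S, inferInstance, fun e s => (e.1 : ℂ) ^ s.1.2.1 * (e.2 : ℂ) ^ s.1.2.2 *
    ((s.1.1.1.1 : ℂ) ^ e.1 * (s.1.1.1.2 : ℂ) ^ e.2), fun D a => ⟨fun h => ?_, fun h => ?_⟩⟩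
  · funext s
    obtain ⟨⟨P, i, j⟩, hs⟩ := s
    simp only [S, Finset.mem_sigma, Multiset.mem_toFinset, Finset.mem_filter] at hs
    simpa using h P hs.1 i j hs.2.2
  · intro P hP i j hij
    have hs : (⟨P, i, j⟩ : Σ _ : (ℂˣ × ℂˣ) × ℕ, ℕ × ℕ) ∈ S := by
      simp only [S, Finset.mem_sigma, Multiset.mem_toFinset, Finset.mem_filter, hP,
        Finset.mem_product, Finset.mem_range, true_and]
      omega
    simpa using congrFun h ⟨_, hs⟩

/-- Degeneration of the points in `Q₁` along a one-parameter subgroup of the torus. -/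
theorem nonSpecial_glue {D₁ D₂ : Finset (ℕ × ℕ)} (hdisj : Disjoint D₁ D₂) (α β : ℤ)
    (Q₁ : Multiset ((ℂˣ × ℂˣ) × ℕ)) (C : ℕ × ℕ → ℕ × ℕ → ℂ)
    (hC : ∀ a, (∀ P ∈ Q₁, LogVanish (D₁ ∪ D₂) a P) →
      ∀ f ∈ D₁, a f = ∑ e ∈ D₂, C f e * a e)
    (hw : ∀ f ∈ D₁, ∀ e ∈ D₂, C f e ≠ 0 → α * f.1 + β * f.2 < α * e.1 + β * e.2)
    {ms : Multiset ℕ} (h₂ : NonSpecial D₂ ms) :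
    NonSpecial (D₁ ∪ D₂) (Q₁.map Prod.snd + ms) := by
  classical
  obtain ⟨Q₂, hQ₂, hinj⟩ := h₂
  obtain ⟨ι, _, c, hc⟩ := exists_conditionVector Q₂
  have : Fintype ι := Fintype.ofFinite ι
  set w : ℕ × ℕ → ℤ := fun e => α * e.1 + β * e.2 with hwdef
  let V : ℂ → D₂ → ι → ℂ := fun t e =>
    c e + ∑ f ∈ D₁, (C f e * t ^ (w e - w f).toNat) • c f
  have hV0 : V 0 = fun e : D₂ => c e := by
    funext e
    simp only [V]
    rw [Finset.sum_eq_zero, add_zero]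
    intro f hf
    by_cases hz : C f e = 0
    · simp [hz]
    · have := hw f hf e e.2 hz
      rw [zero_pow (by simp only [hwdef]; omega)]
      simp
  have hVc : Continuous V := by
    refine continuous_pi fun e => ?_
    refine continuous_const.add (continuous_finsetSum _ fun f _ => ?_)
    exact ((continuous_const.mul (continuous_pow _))).smul continuous_const
  have hopen : IsOpen {t : ℂ | LinearIndependent ℂ (V t)} :=
    (isOpen_setOfPred_linearIndependent (𝕜 := ℂ) (E := ι → ℂ) (ι := D₂)).preimage hVc
  have h0 : (0 : ℂ) ∈ {t : ℂ | LinearIndependent ℂ (V t)} := by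
    change LinearIndependent ℂ (V 0)
    rw [hV0]
    exact linearIndepOn_finset_iff.mpr fun a ha => hinj a ((hc D₂ a).mpr ha)
  obtain ⟨t, ht, ht0⟩ : ∃ t : ℂ, LinearIndependent ℂ (V t) ∧ t ≠ 0 := by
    have h1 : ∀ᶠ t in nhdsWithin (0 : ℂ) {0}ᶜ, LinearIndependent ℂ (V t) :=
      mem_nhdsWithin_of_mem_nhds (hopen.mem_nhds h0)
    have h2 : ∀ᶠ t in nhdsWithin (0 : ℂ) {0}ᶜ, t ≠ 0 := self_mem_nhdsWithin
    exact (h1.and h2).exists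
  let u : ℂˣ := Units.mk0 t ht0
  refine ⟨Q₁.map (fun P => ((u ^ α * P.1.1, u ^ β * P.1.2), P.2)) + Q₂, ?_, fun a ha => ?_⟩
  · simp [Multiset.map_map, hQ₂]
  have hf : ∀ f ∈ D₁, a f = ∑ e ∈ D₂, C f e * t ^ (w e - w f).toNat * a e := by
    intro f hf
    have key := hC (fun e => t ^ (w e) * a e) (fun P hP i j hij => ?_) f hf
    · have ht' : t ^ w f ≠ 0 := zpow_ne_zero _ ht0
      apply mul_left_cancel₀ ht'
      rw [key, Finset.mul_sum]
      refine Finset.sum_congr rfl fun e he => ?_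
      by_cases hz : C f e = 0
      · simp [hz]
      · have hlt := hw f hf e he hz
        have : t ^ w e = t ^ w f * t ^ (w e - w f).toNat := by
          rw [← zpow_natCast, ← zpow_add₀ ht0]
          congr 1
          simp only [hwdef]
          omega
        rw [this]
        ring
    · have := ha _ (Multiset.mem_add.mpr (Or.inl (Multiset.mem_map_of_mem _ hP))) i j hij
      rw [← this]
      refine Finset.sum_congr rfl fun e _ => ?_
      have : t ^ w e = (t ^ α) ^ e.1 * (t ^ β) ^ e.2 := by
        rw [← zpow_natCast (t ^ α), ← zpow_natCast (t ^ β), ← zpow_mul, ← zpow_mul,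
          ← zpow_add₀ ht0]
      simp only [this, Units.val_mul, Units.val_zpow_eq_zpow_val, u, Units.val_mk0, mul_pow]
      ring
  have hzero : ∀ e ∈ D₂, a e = 0 := by
    have h2 := (hc (D₁ ∪ D₂) a).mp fun P hP => ha P (Multiset.mem_add.mpr (Or.inr hP))
    rw [Finset.sum_union hdisj] at h2
    have h3 : ∑ e : D₂, a e • V t e = 0 := by
      rw [← h2]
      simp only [V, smul_add, Finset.sum_add_distrib]
      rw [add_comm, Finset.sum_coe_sort D₂ (fun e => a e • c e)]
      congr 1
      simp only [Finset.smul_sum, smul_smul]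
      rw [Finset.sum_comm]
      refine Finset.sum_congr rfl fun f hf' => ?_
      rw [Finset.sum_coe_sort D₂ (fun e => (a e * (C f e * t ^ (w e - w f).toNat)) • c f),
        ← Finset.sum_smul, hf f hf']
      congr 1
      refine Finset.sum_congr rfl fun e _ => ?_
      ring
    intro e he
    exact Fintype.linearIndependent_iff.mp ht (fun e => a e) h3 ⟨e, he⟩
  intro e he
  rcases Finset.mem_union.mp he with h | h
  · rw [hf e h]
    exact Finset.sum_eq_zero fun e' he' => by rw [hzero e' he', mul_zero]
  · exact hzero e h

theorem nonSpecial_union {D₁ D₂ : Finset (ℕ × ℕ)} (α β : ℤ)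
    (hw : ∀ f ∈ D₁, ∀ e ∈ D₂, α * f.1 + β * f.2 < α * e.1 + β * e.2)
    {ms₁ ms₂ : Multiset ℕ} (h₁ : NonSpecial D₁ ms₁) (h₂ : NonSpecial D₂ ms₂) :
    NonSpecial (D₁ ∪ D₂) (ms₁ + ms₂) := by
  classical
  have hdisj : Disjoint D₁ D₂ :=
    Finset.disjoint_left.mpr fun e h h' => lt_irrefl _ (hw e h e h')
  obtain ⟨Q₁, hQ₁, hinj⟩ := h₁
  obtain ⟨ι, _, c, hc⟩ := exists_conditionVector Q₁
  have hli : LinearIndependent ℂ (fun e : D₁ => c e) :=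
    linearIndepOn_finset_iff.mpr fun a ha => hinj a ((hc D₁ a).mpr ha)
  obtain ⟨g, hg⟩ := LinearMap.exists_leftInverse_of_injective _
    (LinearMap.ker_eq_bot.mpr (hli.fintypeLinearCombination_injective))
  rw [← hQ₁]
  let C : ℕ × ℕ → ℕ × ℕ → ℂ := fun f e => if hf : f ∈ D₁ then - g (c e) ⟨f, hf⟩ else 0
  refine nonSpecial_glue hdisj α β Q₁ C (fun a ha f hf => ?_) (fun f hf e he _ => hw f hf e he) h₂
  have h := (hc _ a).mp ha
  rw [Finset.sum_union hdisj] at h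
  have h1 : g (∑ e ∈ D₁, a e • c e) = fun e : D₁ => a e := by
    have := LinearMap.congr_fun hg (fun e : D₁ => a e)
    simp only [LinearMap.comp_apply, Fintype.linearCombination_apply, LinearMap.id_apply] at this
    rw [← this, ← Finset.sum_coe_sort D₁]
  have h2 := congrFun (congrArg g h) ⟨f, hf⟩
  rw [map_add, h1, map_zero] at h2
  simp only [map_sum, map_smul, Pi.add_apply, Finset.sum_apply, Pi.smul_apply, smul_eq_mul,
    Pi.zero_apply] at h2
  rw [eq_neg_of_add_eq_zero_left h2, ← Finset.sum_neg_distrib]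
  refine Finset.sum_congr rfl fun e _ => ?_
  simp only [C, hf, dite_true]
  ring

theorem LogVanish.sum_eval_eq_zero {D : Finset (ℕ × ℕ)} {a : ℕ × ℕ → ℂ} {k : ℕ}
    (h : LogVanish D a ((1, 1), k)) {q : MvPolynomial (Fin 2) ℂ} (hq : q.totalDegree < k) :
    ∑ e ∈ D, a e * eval ![(e.1 : ℂ), (e.2 : ℂ)] q = 0 := by
  simp only [eval_eq', Finset.mul_sum]
  rw [Finset.sum_comm]
  refine Finset.sum_eq_zero fun s hs => ?_
  have hdeg : s 0 + s 1 < k := by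
    refine lt_of_le_of_lt ?_ hq
    have := le_totalDegree hs
    rwa [Finsupp.sum_fintype _ _ (fun _ => rfl), Fin.sum_univ_two] at this
  have := h (s 0) (s 1) hdeg
  rw [← mul_zero (coeff s q), ← this, Finset.mul_sum]
  refine Finset.sum_congr rfl fun e _ => ?_
  simp [Fin.prod_univ_two]
  ring

/-- Polynomials of degree `< k` dual to the points of a set whose nonempty rows have pairwise
distinct cardinalities at most `k`. -/
theorem exists_dual_polynomial {D : Finset (ℕ × ℕ)} {k : ℕ} {v : ℕ → ℕ}
    (hv : ∀ y, (D.filter fun e => e.2 = y).card = v y) (hk : ∀ y, v y ≤ k)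
    (hinj : ∀ y y', v y ≠ 0 → v y = v y' → y = y') (f : ℕ × ℕ) (hf : f ∈ D) :
    ∃ q : MvPolynomial (Fin 2) ℂ, q.totalDegree < k ∧
      (∀ e ∈ D, eval ![(e.1 : ℂ), (e.2 : ℂ)] q = if e = f then 1 else 0) ∧
      ∀ e : ℕ × ℕ, v f.2 < v e.2 → eval ![(e.1 : ℂ), (e.2 : ℂ)] q = 0 := by
  classical
  induction hn : v f.2 using Nat.strong_induction_on generalizing f with
  | _ n ih =>
    subst hn
    have hpos : ∀ e ∈ D, 0 < v e.2 := fun e he => by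
      rw [← hv]
      exact Finset.card_pos.mpr ⟨e, by simp [he]⟩
    have hrec : ∀ g : ℕ × ℕ, g ∈ D ∧ v g.2 < v f.2 → ∃ q : MvPolynomial (Fin 2) ℂ,
        q.totalDegree < k ∧
        (∀ e ∈ D, eval ![(e.1 : ℂ), (e.2 : ℂ)] q = if e = g then 1 else 0) ∧
        ∀ e : ℕ × ℕ, v g.2 < v e.2 → eval ![(e.1 : ℂ), (e.2 : ℂ)] q = 0 :=
      fun g hg => ih _ hg.2 g hg.1 rfl
    choose! p hpd hp1 hp0 using hrec
    let R := (D.image Prod.snd).filter fun y => v f.2 < v y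
    let S := (D.filter fun e => e.2 = f.2).erase f
    let q₀ : MvPolynomial (Fin 2) ℂ :=
      (∏ y ∈ R, (X 1 - C (y : ℂ))) * ∏ g ∈ S, (X 0 - C (g.1 : ℂ))
    have hR : R.card ≤ k - v f.2 := by
      rw [← Nat.card_Ioc]
      refine Finset.card_le_card_of_injOn v (fun y hy => ?_) (fun y hy y' hy' h => ?_)
      · have := (Finset.mem_filter.mp hy).2
        simp [this, hk]
      · have := (Finset.mem_filter.mp hy).2
        exact hinj y y' (by omega) h
    have hS : S.card = v f.2 - 1 := by
      rw [Finset.card_erase_of_mem (by simp [hf]), hv]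
    have hdeg : q₀.totalDegree < k := by
      have h1 : (∏ y ∈ R, ((X 1 : MvPolynomial (Fin 2) ℂ) - C (y : ℂ))).totalDegree ≤ R.card := by
        refine (totalDegree_finsetProd _ _).trans ?_
        rw [Finset.card_eq_sum_ones]
        exact Finset.sum_le_sum fun y _ => (totalDegree_sub_C_le _ _).trans (by simp)
      have h2 : (∏ g ∈ S, ((X 0 : MvPolynomial (Fin 2) ℂ) - C (g.1 : ℂ))).totalDegree ≤ S.card := by
        refine (totalDegree_finsetProd _ _).trans ?_
        rw [Finset.card_eq_sum_ones]
        exact Finset.sum_le_sum fun y _ => (totalDegree_sub_C_le _ _).trans (by simp)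
      have := totalDegree_mul (∏ y ∈ R, ((X 1 : MvPolynomial (Fin 2) ℂ) - C (y : ℂ)))
        (∏ g ∈ S, ((X 0 : MvPolynomial (Fin 2) ℂ) - C (g.1 : ℂ)))
      have := hpos f hf
      have := hk f.2
      simp only [q₀]
      omega
    have hev : ∀ e : ℕ × ℕ, eval ![(e.1 : ℂ), (e.2 : ℂ)] q₀ =
        (∏ y ∈ R, ((e.2 : ℂ) - y)) * ∏ g ∈ S, ((e.1 : ℂ) - g.1) := fun e => by
      simp [q₀]
    have hff : eval ![(f.1 : ℂ), (f.2 : ℂ)] q₀ ≠ 0 := by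
      rw [hev]
      refine mul_ne_zero (Finset.prod_ne_zero_iff.mpr fun y hy h => ?_)
        (Finset.prod_ne_zero_iff.mpr fun g hg h => ?_)
      · have h' : f.2 = y := by exact_mod_cast sub_eq_zero.mp h
        have := (Finset.mem_filter.mp hy).2
        rw [h'] at this
        exact lt_irrefl _ this
      · have h' : f.1 = g.1 := by exact_mod_cast sub_eq_zero.mp h
        simp only [S, Finset.mem_erase, Finset.mem_filter] at hg
        exact hg.1 (Prod.ext h'.symm hg.2.2)
    have hhigh : ∀ e : ℕ × ℕ, v f.2 < v e.2 → eval ![(e.1 : ℂ), (e.2 : ℂ)] q₀ = 0 := by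
      intro e he
      rw [hev]
      have : e.2 ∈ R := by
        refine Finset.mem_filter.mpr ⟨?_, he⟩
        have h : 0 < v e.2 := by omega
        rw [← hv] at h
        obtain ⟨g, hg⟩ := Finset.card_pos.mp h
        exact Finset.mem_image.mpr ⟨g, (Finset.mem_filter.mp hg).1, (Finset.mem_filter.mp hg).2⟩
      rw [Finset.prod_eq_zero this (sub_self _), zero_mul]
    have hsame : ∀ e ∈ D, v e.2 = v f.2 → e ≠ f → eval ![(e.1 : ℂ), (e.2 : ℂ)] q₀ = 0 := by
      intro e he hvv hne
      rw [hev]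
      have h2 := hinj e.2 f.2 (hpos e he).ne' hvv
      have : e ∈ S := by simp [S, hne, he, h2]
      rw [Finset.prod_eq_zero this (sub_self _), mul_zero]
    let T := D.filter fun g => v g.2 < v f.2
    let b := eval ![(f.1 : ℂ), (f.2 : ℂ)] q₀
    let q : MvPolynomial (Fin 2) ℂ := C b⁻¹ * q₀ -
      ∑ g ∈ T, C (b⁻¹ * eval ![(g.1 : ℂ), (g.2 : ℂ)] q₀) * p g
    have hqe : ∀ e : ℕ × ℕ, eval ![(e.1 : ℂ), (e.2 : ℂ)] q =
        b⁻¹ * eval ![(e.1 : ℂ), (e.2 : ℂ)] q₀ - ∑ g ∈ T,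
          b⁻¹ * eval ![(g.1 : ℂ), (g.2 : ℂ)] q₀ * eval ![(e.1 : ℂ), (e.2 : ℂ)] (p g) := by
      intro e
      simp [q]
    have hT : ∀ e : ℕ × ℕ, v f.2 ≤ v e.2 → ∑ g ∈ T,
          b⁻¹ * eval ![(g.1 : ℂ), (g.2 : ℂ)] q₀ * eval ![(e.1 : ℂ), (e.2 : ℂ)] (p g) = 0 := by
      intro e he
      refine Finset.sum_eq_zero fun g hg => ?_
      have hg := Finset.mem_filter.mp hg
      rw [hp0 g hg e (by omega), mul_zero]
    refine ⟨q, ?_, fun e he => ?_, fun e he => ?_⟩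
    · have hk0 : 0 < k := by omega
      have hC : ∀ (c : ℂ) (r : MvPolynomial (Fin 2) ℂ), r.totalDegree < k →
          (C c * r).totalDegree ≤ k - 1 := fun c r hr => by
        have := totalDegree_mul (C c) r
        rw [totalDegree_C] at this
        omega
      have h1 : q.totalDegree ≤ k - 1 := by
        refine (totalDegree_sub _ _).trans (max_le (hC _ _ hdeg) ?_)
        exact totalDegree_finsetSum_le fun g hg => hC _ _ (hpd g (Finset.mem_filter.mp hg))
      omega
    · rw [hqe]
      rcases lt_trichotomy (v e.2) (v f.2) with h | h | h
      · have heT : e ∈ T := by simp [T, he, h]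
        rw [Finset.sum_eq_single e]
        · rw [hp1 e ⟨he, h⟩ e he, if_pos rfl, mul_one, sub_self, if_neg]
          rintro rfl
          exact lt_irrefl _ h
        · intro g hg hge
          rw [hp1 g (Finset.mem_filter.mp hg) e he, if_neg hge.symm, mul_zero]
        · exact fun h => absurd heT h
      · rw [hT e h.ge, sub_zero]
        by_cases hef : e = f
        · subst hef
          rw [if_pos rfl]
          exact inv_mul_cancel₀ hff
        · rw [hsame e he h hef, if_neg hef, mul_zero]
      · rw [hT e h.le, hhigh e h, if_neg, mul_zero, sub_zero]
        rintro rfl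
        exact lt_irrefl _ h
    · rw [hqe, hT e he.le, hhigh e he, mul_zero, sub_zero]

/-- One point of multiplicity `k` is absorbed by a set of monomials whose rows have pairwise
distinct sizes at most `k`. -/
theorem nonSpecial_cons {D D₁ : Finset (ℕ × ℕ)} (hD : D₁ ⊆ D) {k : ℕ} {v : ℕ → ℕ} (α β : ℤ)
    (hv : ∀ y, (D₁.filter fun e => e.2 = y).card = v y) (hk : ∀ y, v y ≤ k)
    (hinj : ∀ y y', v y ≠ 0 → v y = v y' → y = y')
    (hw : ∀ f ∈ D₁, ∀ e ∈ D \ D₁, v e.2 ≤ v f.2 → α * f.1 + β * f.2 < α * e.1 + β * e.2)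
    {ms : Multiset ℕ} (h : NonSpecial (D \ D₁) ms) : NonSpecial D (k ::ₘ ms) := by
  classical
  choose! q hqd hq1 hq0 using exists_dual_polynomial hv hk hinj
  have key := nonSpecial_glue (Finset.disjoint_sdiff (s := D₁) (t := D)) α β {((1, 1), k)}
    (fun f e => - eval ![(e.1 : ℂ), (e.2 : ℂ)] (q f)) (fun a ha f hf => ?_)
    (fun f hf e he hne => hw f hf e he ?_) h
  · rw [Finset.union_sdiff_of_subset hD] at key
    simpa using key
  · have := (ha _ (Multiset.mem_singleton_self _)).sum_eval_eq_zero (hqd f hf)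
    rw [Finset.sum_union Finset.disjoint_sdiff] at this
    have h1 : ∑ e ∈ D₁, a e * eval ![(e.1 : ℂ), (e.2 : ℂ)] (q f) = a f := by
      rw [Finset.sum_congr rfl fun e he => by rw [hq1 f hf e he]]
      simp [hf]
    rw [h1] at this
    rw [eq_neg_of_add_eq_zero_left this, ← Finset.sum_neg_distrib]
    refine Finset.sum_congr rfl fun e _ => ?_
    ring
  · by_contra hlt
    exact hne (by rw [hq0 f hf e (by omega), neg_zero])

/-- The lattice points `(x, y)` with `y < n` and `g y ≤ x < h y`. -/
def rows (n : ℕ) (g h : ℕ → ℕ) : Finset (ℕ × ℕ) :=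
  (Finset.range n).biUnion fun y => (Finset.Ico (g y) (h y)).image fun x => (x, y)

theorem mem_rows {n : ℕ} {g h : ℕ → ℕ} {e : ℕ × ℕ} :
    e ∈ rows n g h ↔ e.2 < n ∧ g e.2 ≤ e.1 ∧ e.1 < h e.2 := by
  obtain ⟨x, y⟩ := e
  simp [rows]

theorem card_row {n : ℕ} {g h : ℕ → ℕ} {y : ℕ} (hy : y < n) :
    ((rows n g h).filter fun e => e.2 = y).card = h y - g y := by
  rw [← Nat.card_Ico, ← Finset.card_image_of_injective (Finset.Ico (g y) (h y))
    (Prod.mk_left_injective y)]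
  congr 1
  ext ⟨x, z⟩
  simp only [Finset.mem_filter, mem_rows, Finset.mem_image, Finset.mem_Ico, Prod.mk.injEq]
  constructor
  · rintro ⟨h1, rfl⟩
    exact ⟨x, h1.2, rfl, rfl⟩
  · rintro ⟨_, h1, rfl, rfl⟩
    exact ⟨⟨hy, h1⟩, rfl⟩

theorem card_row_eq_zero {n : ℕ} {g h : ℕ → ℕ} {y : ℕ} (hy : n ≤ y) :
    ((rows n g h).filter fun e => e.2 = y).card = 0 := by
  rw [Finset.card_eq_zero, Finset.filter_eq_empty_iff]
  intro e he hey
  have := (mem_rows.mp he).1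
  omega

theorem card_rows (n : ℕ) (g h : ℕ → ℕ) :
    (rows n g h).card = ∑ y ∈ Finset.range n, (h y - g y) := by
  rw [Finset.card_eq_sum_card_fiberwise (f := Prod.snd) (t := Finset.range n)
    (fun e he => by simpa using (mem_rows.mp he).1)]
  exact Finset.sum_congr rfl fun y hy => card_row (Finset.mem_range.mp hy)

/-- The number of conditions imposed by a point of multiplicity `k`. -/
def tri (k : ℕ) : ℕ := k * (k + 1) / 2

theorem two_mul_tri (k : ℕ) : 2 * tri k = k * (k + 1) :=
  Nat.mul_div_cancel' (Nat.even_mul_succ_self k).two_dvd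

/-- The values `1, …, k` are each taken exactly once by `v`, on arguments below `n`, and all
other values of `v` are zero. -/
structure IsStair (k n : ℕ) (v : ℕ → ℕ) : Prop where
  le : ∀ y, v y ≤ k
  inj : ∀ y y', v y ≠ 0 → v y = v y' → y = y'
  surj : ∀ j, 1 ≤ j → j ≤ k → ∃ y, v y = j
  zero : ∀ y, n ≤ y → v y = 0

theorem IsStair.sum {k n : ℕ} {v : ℕ → ℕ} (hv : IsStair k n v) :
    ∑ y ∈ Finset.range n, v y = tri k := by
  have h1 : ∑ y ∈ Finset.range n, v y = ∑ j ∈ Finset.Icc 1 k, j := by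
    rw [← Finset.sum_filter_ne_zero]
    refine Finset.sum_bij (fun y _ => v y) (fun y hy => ?_) (fun y hy y' hy' h => ?_)
      (fun j hj => ?_) (fun _ _ => rfl)
    · have := (Finset.mem_filter.mp hy).2
      have := hv.le y
      simp only [Finset.mem_Icc]
      omega
    · exact hv.inj y y' (Finset.mem_filter.mp hy).2 h
    · rw [Finset.mem_Icc] at hj
      obtain ⟨y, rfl⟩ := hv.surj j hj.1 hj.2
      refine ⟨y, Finset.mem_filter.mpr ⟨?_, by omega⟩, rfl⟩
      by_contra hy
      have := hv.zero y (by simpa using hy)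
      omega
  have h2 : ∑ j ∈ Finset.Icc 1 k, j = ∑ j ∈ Finset.range (k + 1), j := by
    refine Finset.sum_subset (fun j hj => ?_) fun j hj hj' => ?_
    · simp only [Finset.mem_Icc, Finset.mem_range] at hj ⊢
      omega
    · simp only [Finset.mem_Icc, Finset.mem_range] at hj hj'
      omega
  rw [h1, h2, Finset.sum_range_id, tri, Nat.add_sub_cancel, mul_comm]

/-- Removing a staircase from the right ends of the rows, highest rows first. -/
theorem nonSpecial_rows_right {k n : ℕ} {g h v : ℕ → ℕ} (hv : IsStair k n v)
    (hvh : ∀ y, v y ≤ h y - g y)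
    (hord : ∀ y y', y ≠ y' → y < n → 1 ≤ v y' → v y < h y - g y → v y ≤ v y' → y < y')
    {ms : Multiset ℕ} (H : NonSpecial (rows n g fun y => h y - v y) ms) :
    NonSpecial (rows n g h) (k ::ₘ ms) := by
  have hsub : rows n (fun y => h y - v y) h ⊆ rows n g h := fun e he => by
    rw [mem_rows] at he ⊢
    have := hvh e.2
    omega
  have hdiff : rows n g h \ rows n (fun y => h y - v y) h = rows n g fun y => h y - v y := by
    ext e
    rw [Finset.mem_sdiff, mem_rows, mem_rows, mem_rows]
    have := hvh e.2
    omega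
  rw [← hdiff] at H
  let N := (Finset.range n).sup h
  refine nonSpecial_cons hsub (v := v) (-1) (-(N : ℤ)) (fun y => ?_) hv.le hv.inj
    (fun f hf e he hle => ?_) H
  · rcases lt_or_ge y n with hy | hy
    · rw [card_row hy]
      have := hvh y
      omega
    · rw [card_row_eq_zero hy, hv.zero y hy]
  · rw [hdiff] at he
    rw [mem_rows] at he hf
    have hvf := hvh f.2
    have hve := hvh e.2
    by_cases hy : e.2 = f.2
    · rw [hy] at he ⊢
      omega
    · have hlt := hord e.2 f.2 hy he.1 (by omega) (by omega) hle
      have hN : h e.2 ≤ N := Finset.le_sup (f := h) (Finset.mem_range.mpr he.1)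
      have : (N : ℤ) * (e.2 + 1) ≤ N * f.2 :=
        mul_le_mul_of_nonneg_left (by exact_mod_cast hlt) (by positivity)
      have hx : (e.1 : ℤ) < N := by omega
      have hx' : (0 : ℤ) ≤ f.1 := by positivity
      linarith

/-- Removing a staircase from the left ends of the rows, compatibly with the weight
`A x - B y`. -/
theorem nonSpecial_rows_left {k n : ℕ} {g h v : ℕ → ℕ} (hv : IsStair k n v) (A B : ℤ) (hA : 1 ≤ A)
    (hvh : ∀ y, y < n → g y + v y ≤ h y)
    (hord : ∀ y y', y < n → y' < n → v y < v y' → A * g y' + A * k - B * y' ≤ A * g y - B * y)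
    {ms : Multiset ℕ} (H : NonSpecial (rows n (fun y => g y + v y) h) ms) :
    NonSpecial (rows n g h) (k ::ₘ ms) := by
  have hsub : rows n g (fun y => g y + v y) ⊆ rows n g h := fun e he => by
    rw [mem_rows] at he ⊢
    have := hvh e.2 he.1
    omega
  have hdiff : rows n g h \ rows n g (fun y => g y + v y) = rows n (fun y => g y + v y) h := by
    ext e
    rw [Finset.mem_sdiff, mem_rows, mem_rows, mem_rows]
    omega
  rw [← hdiff] at H
  refine nonSpecial_cons hsub (v := v) A (-B) (fun y => ?_) hv.le hv.inj
    (fun f hf e he hle => ?_) H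
  · rcases lt_or_ge y n with hy | hy
    · rw [card_row hy]
      omega
    · rw [card_row_eq_zero hy, hv.zero y hy]
  · rw [hdiff] at he
    rw [mem_rows] at he hf
    by_cases hy : e.2 = f.2
    · rw [hy] at he ⊢
      have h1 : (f.1 : ℤ) + 1 ≤ e.1 := by omega
      nlinarith
    · have hlt : v e.2 < v f.2 := by
        refine lt_of_le_of_ne hle fun heq => hy ?_
        exact hv.inj _ _ (by omega) heq
      have h1 := hord e.2 f.2 he.1 hf.1 hlt
      have h2 : (f.1 : ℤ) + 1 ≤ g f.2 + k := by
        have := hv.le f.2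
        omega
      have h3 : (g e.2 : ℤ) ≤ e.1 := by omega
      nlinarith

/-- `D` is exactly filled by points of multiplicity `k`. -/
def Tight (k : ℕ) (D : Finset (ℕ × ℕ)) : Prop :=
  ∃ n, D.card = n * tri k ∧ NonSpecial D (Multiset.replicate n k)

theorem tight_empty (k : ℕ) : Tight k ∅ := ⟨0, by simp, nonSpecial_empty _⟩

theorem Tight.union {k : ℕ} {D₁ D₂ : Finset (ℕ × ℕ)} (h₁ : Tight k D₁) (h₂ : Tight k D₂)
    (α β : ℤ) (hw : ∀ f ∈ D₁, ∀ e ∈ D₂, α * f.1 + β * f.2 < α * e.1 + β * e.2) :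
    Tight k (D₁ ∪ D₂) := by
  obtain ⟨n₁, hn₁, h₁⟩ := h₁
  obtain ⟨n₂, hn₂, h₂⟩ := h₂
  refine ⟨n₁ + n₂, ?_, ?_⟩
  · rw [Finset.card_union_of_disjoint, hn₁, hn₂, add_mul]
    exact Finset.disjoint_left.mpr fun e h h' => lt_irrefl _ (hw e h e h')
  · rw [Multiset.replicate_add]
    exact nonSpecial_union α β hw h₁ h₂

theorem Tight.swap {k : ℕ} {D : Finset (ℕ × ℕ)} (h : Tight k D) : Tight k (D.image Prod.swap) := by
  obtain ⟨n, hn, h⟩ := h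
  exact ⟨n, by rw [Finset.card_image_of_injective _ Prod.swap_injective, hn], h.swap⟩

theorem Tight.rows_right {k n : ℕ} {g h v : ℕ → ℕ} (hv : IsStair k n v)
    (hvh : ∀ y, v y ≤ h y - g y)
    (hord : ∀ y y', y ≠ y' → y < n → 1 ≤ v y' → v y < h y - g y → v y ≤ v y' → y < y')
    (H : Tight k (rows n g fun y => h y - v y)) : Tight k (rows n g h) := by
  obtain ⟨N, hN, H⟩ := H
  refine ⟨N + 1, ?_, ?_⟩
  · rw [add_mul, one_mul, ← hN, card_rows, card_rows, ← hv.sum, ← Finset.sum_add_distrib]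
    refine Finset.sum_congr rfl fun y _ => ?_
    have := hvh y
    omega
  · rw [Multiset.replicate_succ]
    exact nonSpecial_rows_right hv hvh hord H

theorem Tight.rows_left {k n : ℕ} {g h v : ℕ → ℕ} (hv : IsStair k n v) (A B : ℤ) (hA : 1 ≤ A)
    (hvh : ∀ y, y < n → g y + v y ≤ h y)
    (hord : ∀ y y', y < n → y' < n → v y < v y' → A * g y' + A * k - B * y' ≤ A * g y - B * y)
    (H : Tight k (rows n (fun y => g y + v y) h)) : Tight k (rows n g h) := by
  obtain ⟨N, hN, H⟩ := H
  refine ⟨N + 1, ?_, ?_⟩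
  · rw [add_mul, one_mul, ← hN, card_rows, card_rows, ← hv.sum, ← Finset.sum_add_distrib]
    refine Finset.sum_congr rfl fun y hy => ?_
    have := hvh y (Finset.mem_range.mp hy)
    omega
  · rw [Multiset.replicate_succ]
    exact nonSpecial_rows_left hv A B hA hvh hord H

theorem tight_of_isStair {k n : ℕ} {g h : ℕ → ℕ} (hv : IsStair k n fun y => h y - g y) :
    Tight k (rows n g h) := by
  refine Tight.rows_right hv (fun y => le_rfl) (fun y y' _ _ _ h => absurd h (lt_irrefl _)) ?_
  convert tight_empty k
  refine Finset.eq_empty_of_forall_notMem fun e he => ?_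
  rw [mem_rows] at he
  omega

/-- Every rectangle of width `a` and height `b` is tight. -/
def RectTight (k a b : ℕ) : Prop :=
  ∀ x y, Tight k (Finset.Ico x (x + a) ×ˢ Finset.Ico y (y + b))

theorem RectTight.swap {k a b : ℕ} (h : RectTight k a b) : RectTight k b a := by
  intro x y
  convert (h y x).swap using 1
  ext ⟨u, v⟩
  simp

theorem RectTight.add_left {k a a' b : ℕ} (h : RectTight k a b) (h' : RectTight k a' b) :
    RectTight k (a + a') b := by
  intro x y
  convert (h x y).union (h' (x + a) y) 1 0 (fun f hf e he => ?_) using 1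
  · ext ⟨u, v⟩
    simp only [Finset.mem_product, Finset.mem_Ico, Finset.mem_union]
    omega
  · simp only [Finset.mem_product, Finset.mem_Ico] at hf he
    omega

theorem RectTight.add_right {k a b b' : ℕ} (h : RectTight k a b) (h' : RectTight k a b') :
    RectTight k a (b + b') :=
  (h.swap.add_left h'.swap).swap

theorem RectTight.mul_left {k a b : ℕ} (h : RectTight k a b) (i : ℕ) : RectTight k (i * a) b := by
  induction i with
  | zero =>
    intro x y
    convert tight_empty k
    simp
  | succ i ih =>
    rw [add_mul, one_mul]
    exact ih.add_left h

theorem RectTight.mul_right {k a b : ℕ} (h : RectTight k a b) (j : ℕ) : RectTight k a (j * b) :=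
  (h.swap.mul_left j).swap

theorem rectTight_self_succ (k : ℕ) : RectTight k k (k + 1) := by
  intro x y
  have h1 : Tight k (rows (y + k) (fun _ => x) fun z => if y ≤ z then x + (y + k - z) else x) := by
    refine tight_of_isStair ⟨fun z => ?_, fun z z' => ?_, fun j hj hjk => ⟨y + k - j, ?_⟩,
      fun z => ?_⟩ <;> grind
  have h2 : Tight k (rows (y + k + 1)
      (fun z => if y ≤ z ∧ z ≤ y + k then x + (y + k - z) else x + k) fun _ => x + k) := by
    refine tight_of_isStair ⟨fun z => ?_, fun z z' => ?_, fun j hj hjk => ⟨y + j, ?_⟩,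
      fun z => ?_⟩ <;> grind
  convert h1.union h2 1 1 (fun f hf e he => ?_) using 1
  · ext ⟨u, v⟩
    simp only [Finset.mem_product, Finset.mem_Ico, Finset.mem_union, mem_rows]
    grind
  · simp only [mem_rows] at hf he
    grind

theorem rectTight_mul_succ {k : ℕ} (hk : 1 ≤ k) {w : ℕ} (hw : k * k ≤ w) :
    RectTight k (k * (k + 1)) w := by
  have hdiv := Nat.div_add_mod w k
  have hmod := Nat.mod_lt w hk
  have hq : k ≤ w / k := (Nat.le_div_iff_mul_le hk).mpr hw
  obtain ⟨i, hi⟩ := Nat.exists_eq_add_of_le (hmod.le.trans hq)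
  have hw' : w = w % k * (k + 1) + i * k := by
    conv_lhs => rw [← hdiv, hi]
    ring
  rw [hw']
  refine RectTight.add_right ?_ ?_
  · rw [mul_comm k]
    exact ((rectTight_self_succ k).mul_right _).mul_left _
  · exact ((rectTight_self_succ k).swap.mul_right _).mul_left _

/-- Regions whose rows start at `0` and have decreasing lengths divisible by `k (k + 1)`. -/
theorem tight_rows_of_dvd {k n : ℕ} (hk : 1 ≤ k) (hn : k * k ≤ n) {h : ℕ → ℕ}
    (hanti : ∀ y y', y ≤ y' → y' < n → h y' ≤ h y) (hdvd : ∀ y, y < n → k * (k + 1) ∣ h y)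
    (hconst : ∀ y, y < k * k → h y = h 0) : Tight k (rows n (fun _ => 0) h) := by
  have hkk : 0 < k * k := by positivity
  obtain ⟨c, hc⟩ := hdvd 0 (by omega)
  induction c generalizing h with
  | zero =>
    convert tight_empty k
    refine Finset.eq_empty_of_forall_notMem fun e he => ?_
    rw [mem_rows] at he
    have := hanti 0 e.2 (Nat.zero_le _) he.1
    omega
  | succ c ih =>
    have hex : ∃ w, ¬ (w < n ∧ h w = h 0) := ⟨n, by simp⟩
    classical
    let w := Nat.find hex
    have hw1 : ¬ (w < n ∧ h w = h 0) := Nat.find_spec hex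
    have hw2 : ∀ y, y < w → y < n ∧ h y = h 0 := fun y hy => by
      by_contra h
      exact Nat.find_min hex hy h
    have hw3 : ∀ y, w ≤ y → y < n → h y < h 0 := fun y hwy hy => by
      have h1 := hanti w y hwy hy
      have h2 := hanti 0 w (Nat.zero_le _) (by omega)
      by_contra h3
      exact hw1 ⟨by omega, by omega⟩
    have hkw : k * k ≤ w := by
      by_contra hlt
      exact hw1 ⟨by omega, hconst w (by omega)⟩
    set q := k * (k + 1) with hq
    have hsmall : ∀ y, w ≤ y → y < n → h y ≤ q * c := fun y hwy hy => by
      obtain ⟨d, hd⟩ := hdvd y hy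
      have h1 := hw3 y hwy hy
      rw [hd, hc] at h1
      have h2 : d < c + 1 := lt_of_mul_lt_mul_left h1 (Nat.zero_le _)
      rw [hd]
      exact Nat.mul_le_mul_left _ (by omega)
    have hc' : h 0 = q * c + q := by rw [hc]; ring
    have hrest : Tight k (rows n (fun _ => 0) fun y => min (h y) (q * c)) := by
      refine ih (fun y y' hy hy' => ?_) (fun y hy => ?_) (fun y hy => ?_) ?_
      · have := hanti y y' hy hy'
        omega
      · rcases min_choice (h y) (q * c) with h | h <;> rw [h]
        · exact hdvd y hy
        · exact dvd_mul_right _ _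
      · rw [hconst y hy]
      · rw [hc']
        omega
    convert (rectTight_mul_succ hk hkw (q * c) 0).union hrest (-1) 0 (fun f hf e he => ?_) using 1
    · ext ⟨u, v⟩
      simp only [Finset.mem_product, Finset.mem_Ico, Finset.mem_union, mem_rows, ← hq]
      have := hw2 v
      have := hsmall v
      omega
    · simp only [mem_rows, Finset.mem_product, Finset.mem_Ico] at hf he
      omega

theorem Tight.rows_right_iterate {k n : ℕ} {g v : ℕ → ℕ} (hv : IsStair k n v)
    (hord : ∀ y y', y ≠ y' → y < n → 1 ≤ v y' → v y ≤ v y' → y < y') (c : ℕ) {h : ℕ → ℕ}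
    (hvh : ∀ y, c * v y ≤ h y - g y)
    (H : Tight k (rows n g fun y => h y - c * v y)) : Tight k (rows n g h) := by
  induction c generalizing h with
  | zero => simpa using H
  | succ c ih =>
    have hvh' : ∀ y, c * v y + v y ≤ h y - g y := fun y => by
      have := hvh y
      rwa [add_mul, one_mul] at this
    refine Tight.rows_right hv (fun y => (Nat.le_add_left _ _).trans (hvh' y))
      (fun y y' hne hy h1 _ hle => hord y y' hne hy h1 hle) (ih (fun y => ?_) ?_)
    · have := hvh' y
      omega
    · convert H using 3 with y
      rw [add_mul, one_mul]
      omega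

theorem Tight.rows_left_iterate {k n : ℕ} {h v : ℕ → ℕ} (hv : IsStair k n v) (A B : ℤ)
    (hA : 1 ≤ A) (c : ℕ) {g : ℕ → ℕ} (hvh : ∀ y, y < n → g y + c * v y ≤ h y)
    (hord : ∀ j, j < c → ∀ y y', y < n → y' < n → v y < v y' →
      A * (g y' + j * v y') + A * k - B * y' ≤ A * (g y + j * v y) - B * y)
    (H : Tight k (rows n (fun y => g y + c * v y) h)) : Tight k (rows n g h) := by
  induction c generalizing g with
  | zero => simpa using H
  | succ c ih =>
    have hvh' : ∀ y, y < n → g y + (c * v y + v y) ≤ h y := fun y hy => by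
      have := hvh y hy
      rwa [add_mul, one_mul] at this
    refine Tight.rows_left hv A B hA (fun y hy => ?_) (fun y y' hy hy' hlt => ?_)
      (ih (fun y hy => ?_) (fun j hj y y' hy hy' hlt => ?_) ?_)
    · have := hvh' y hy
      omega
    · simpa using hord 0 (Nat.succ_pos c) y y' hy hy' hlt
    · have := hvh' y hy
      omega
    · have := hord (j + 1) (by omega) y y' hy hy' hlt
      push_cast at this ⊢
      linarith
    · convert H using 3 with y
      rw [add_mul, one_mul]
      omega

/-- Clearing the top `j` rows, whose lengths are sufficiently divisible. -/
theorem tight_of_exhaust {k : ℕ} (hk : 1 ≤ k) {g : ℕ → ℕ} (j : ℕ) {n : ℕ} {h : ℕ → ℕ}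
    (hn : k * k + k + j ≤ n)
    (hanti : ∀ y y', y ≤ y' → y' < n → h y' - g y' ≤ h y - g y)
    (hdvd : ∀ y, y < n → k * (k + 1) * k ^ j ∣ h y - g y)
    (hg : ∀ y, y < n - j → g y = 0) (hconst : ∀ y, y < k * k → h y = h 0) :
    Tight k (rows n g h) := by
  induction j generalizing n h with
  | zero =>
    have : rows n g h = rows n (fun _ => 0) h := by
      ext e
      have := hg e.2
      rw [mem_rows, mem_rows]
      omega
    rw [this]
    refine tight_rows_of_dvd hk (by omega) (fun y y' hy hy' => ?_) (fun y hy => ?_) hconst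
    · have := hanti y y' hy hy'
      rwa [hg y (by omega), hg y' (by omega)] at this
    · have := hdvd y hy
      rwa [hg y (by omega), pow_zero, mul_one] at this
  | succ j ih =>
    obtain ⟨c, hc⟩ : k ∣ h (n - 1) - g (n - 1) :=
      ((dvd_pow_self k (Nat.succ_ne_zero j)).mul_left _).trans (hdvd _ (by omega))
    have hcd : k * (k + 1) * k ^ j ∣ c := by
      have := hdvd (n - 1) (by omega)
      rw [hc, pow_succ, ← mul_assoc, mul_comm k c] at this
      exact Nat.dvd_of_mul_dvd_mul_right hk this
    let v : ℕ → ℕ := fun y => if y < n then y + k + 1 - n else 0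
    have hv : IsStair k n v := by
      refine ⟨fun y => ?_, fun y y' => ?_, fun i hi hik => ⟨n + i - k - 1, ?_⟩, fun y => ?_⟩ <;>
        simp only [v] <;> split_ifs <;> omega
    have hcv : ∀ y, y < n → c * v y ≤ h y - g y := fun y hy => by
      have h1 := hanti y (n - 1) (by omega) (by omega)
      rw [hc] at h1
      have h2 := Nat.mul_le_mul_left c (hv.le y)
      rw [mul_comm c k] at h2
      omega
    refine Tight.rows_right_iterate hv (fun y y' => by simp only [v]; split_ifs <;> omega) c
      (fun y => ?_) ?_
    · by_cases hy : y < n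
      · exact hcv y hy
      · simp [v, hy]
    · have hrow : rows n g (fun y => h y - c * v y) = rows (n - 1) g (fun y => h y - c * v y) := by
        ext e
        have h1 : v (n - 1) = k := by simp only [v]; split_ifs <;> omega
        have h2 : e.2 = n - 1 → h e.2 - c * v e.2 ≤ g e.2 := fun he => by
          rw [he, h1, mul_comm c k]
          omega
        rw [mem_rows, mem_rows]
        omega
      rw [hrow]
      have hsub : ∀ y, h y - c * v y - g y = h y - g y - c * v y := fun y => by omega
      refine ih (by omega) (fun y y' hy hy' => ?_) (fun y hy => ?_) (fun y hy => hg y (by omega))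
        (fun y hy => ?_)
      · rw [hsub, hsub]
        have h1 := hanti y y' hy (by omega)
        have h2 : v y ≤ v y' := by simp only [v]; split_ifs <;> omega
        exact tsub_le_tsub h1 (Nat.mul_le_mul_left c h2)
      · rw [hsub]
        refine Nat.dvd_sub ?_ (hcd.mul_right _)
        refine dvd_trans ?_ (hdvd y (by omega))
        exact Nat.mul_dvd_mul_left _ (pow_dvd_pow k (Nat.le_succ j))
      · have h1 : v y = 0 := by simp only [v]; split_ifs <;> omega
        have h2 : v 0 = 0 := by simp only [v]; split_ifs <;> omega
        rw [hconst y hy, h1, h2]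

theorem card_rows_left {n : ℕ} {g h u : ℕ → ℕ} (hu : ∀ y, y < n → g y + u y ≤ h y) :
    (rows n g h).card = (rows n (fun y => g y + u y) h).card + ∑ y ∈ Finset.range n, u y := by
  rw [card_rows, card_rows, ← Finset.sum_add_distrib]
  refine Finset.sum_congr rfl fun y hy => ?_
  have := hu y (Finset.mem_range.mp hy)
  omega

/-- A staircase on the rows `M, …, M + k`, in which row `M` takes the value `k - i`. -/
def crossStair (k M i y : ℕ) : ℕ :=
  if y < M then 0 else if y = M then k - i else if y ≤ M + i then k + 1 - (y - M) else k - (y - M)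

theorem isStair_crossStair {k M i : ℕ} (hi : i ≤ k) :
    IsStair k (M + k + 1) (crossStair k M i) := by
  refine ⟨fun y => ?_, fun y y' => ?_, fun j hj hjk => ?_, fun y => ?_⟩
  · simp only [crossStair]
    split_ifs <;> omega
  · simp only [crossStair]
    split_ifs <;> omega
  · rcases lt_trichotomy j (k - i) with h | h | h
    · refine ⟨M + (k - j), ?_⟩
      simp only [crossStair]
      split_ifs <;> omega
    · refine ⟨M, ?_⟩
      simp [crossStair, h]
    · refine ⟨M + (k + 1 - j), ?_⟩
      simp only [crossStair]
      split_ifs <;> omega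
  · simp only [crossStair]
    split_ifs <;> omega

/-- Left ends of the rows for which the pieces `crossStair` can be removed in any order. -/
def kinkedEnds (k M s t y : ℕ) : ℕ := if y ≤ M then t * (y + k - M) else s * (y - M)

theorem crossStair_order {k M i s t K : ℕ} (hi : i ≤ k) (ht : (2 * k + 1) * (K + k) ≤ k * t)
    (hs : (2 * k + 4) * (k * t) ≤ s) {g : ℕ → ℕ}
    (hg : ∀ y, y < M + k + 1 → kinkedEnds k M s t y ≤ g y ∧ g y ≤ kinkedEnds k M s t y + K)
    (y y' : ℕ) (hy : y < M + k + 1) (hy' : y' < M + k + 1)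
    (hlt : crossStair k M i y < crossStair k M i y') :
    (2 * i + 1 : ℤ) * g y' + (2 * i + 1) * k - ((2 * i + 1) * s - 2 * (k * t)) * y' ≤
      (2 * i + 1) * g y - ((2 * i + 1) * s - 2 * (k * t)) * y := by
  set τ : ℤ := (k * t : ℤ) with hτ
  have hi' : (i : ℤ) ≤ k := by exact_mod_cast hi
  have hi0 : (0 : ℤ) ≤ i := by positivity
  have hτ0 : 0 ≤ τ := by positivity
  have ht' : (2 * k + 1 : ℤ) * (K + k) ≤ τ := by rw [hτ]; exact_mod_cast ht
  have hs' : (2 * k + 4 : ℤ) * τ ≤ s := by rw [hτ]; exact_mod_cast hs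
  have hs0 : (0 : ℤ) ≤ s := by positivity
  have hslack : (2 * i + 1 : ℤ) * (K + k) ≤ τ :=
    le_trans (mul_le_mul_of_nonneg_right (by linarith) (by positivity)) ht'
  have hA : (0 : ℤ) ≤ 2 * i + 1 := by positivity
  obtain ⟨hgl, -⟩ := hg y hy
  obtain ⟨-, hgu⟩ := hg y' hy'
  have hgl' : (2 * i + 1 : ℤ) * kinkedEnds k M s t y ≤ (2 * i + 1) * g y :=
    mul_le_mul_of_nonneg_left (by exact_mod_cast hgl) hA
  have hgu' : (2 * i + 1 : ℤ) * g y' ≤ (2 * i + 1) * (kinkedEnds k M s t y' + K) :=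
    mul_le_mul_of_nonneg_left (by exact_mod_cast hgu) hA
  suffices h : (2 * i + 1 : ℤ) * kinkedEnds k M s t y' - ((2 * i + 1) * s - 2 * τ) * (y' - M) + τ ≤
      (2 * i + 1) * kinkedEnds k M s t y - ((2 * i + 1) * s - 2 * τ) * (y - M) by
    linarith
  have hM : M ≤ y' := by
    by_contra h
    simp only [crossStair] at hlt
    rw [if_pos (show y' < M by omega)] at hlt
    omega
  have hupper : M < y → ((2 * i + 1 : ℤ) * kinkedEnds k M s t y -
      ((2 * i + 1) * s - 2 * τ) * (y - M)) = 2 * τ * (y - M) := fun h => by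
    rw [kinkedEnds, if_neg (by omega)]
    push_cast [Nat.cast_sub h.le]
    ring
  have hupper' : M < y' → ((2 * i + 1 : ℤ) * kinkedEnds k M s t y' -
      ((2 * i + 1) * s - 2 * τ) * (y' - M)) = 2 * τ * (y' - M) := fun h => by
    rw [kinkedEnds, if_neg (by omega)]
    push_cast [Nat.cast_sub h.le]
    ring
  have hmid : ((2 * i + 1 : ℤ) * kinkedEnds k M s t M -
      ((2 * i + 1) * s - 2 * τ) * (M - M)) = (2 * i + 1) * τ := by
    rw [kinkedEnds, if_pos le_rfl]
    simp only [Nat.add_sub_cancel_left, hτ]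
    push_cast
    ring
  rcases lt_trichotomy y M with h | rfl | h
  · have hlow : τ * (2 * k + 2) ≤ (2 * i + 1 : ℤ) * kinkedEnds k M s t y -
        ((2 * i + 1) * s - 2 * τ) * (y - M) := by
      have h1 : (0 : ℤ) ≤ (2 * i + 1 : ℤ) * kinkedEnds k M s t y := by positivity
      have h2 : (1 : ℤ) ≤ M - y := by
        have : (y : ℤ) + 1 ≤ M := by exact_mod_cast h
        linarith
      have h3 : (s : ℤ) ≤ (2 * i + 1) * s := by linarith [mul_nonneg hi0 hs0]
      have h4 : (2 * k + 2 : ℤ) * τ ≤ (2 * i + 1) * s - 2 * τ := by linarith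
      have h5 := mul_le_mul_of_nonneg_left h2 ((by positivity : 0 ≤ (2 * k + 2 : ℤ) * τ).trans h4)
      linarith
    rcases hM.eq_or_lt with rfl | h'
    · rw [hmid]
      linarith [mul_le_mul_of_nonneg_right hi' hτ0]
    · rw [hupper' h']
      have : (y' : ℤ) - M ≤ k := by
        have : (y' : ℤ) < M + k + 1 := by exact_mod_cast hy'
        linarith
      linarith [mul_le_mul_of_nonneg_left this hτ0]
  · rcases hM.eq_or_lt with rfl | h'
    · exact absurd hlt (lt_irrefl _)
    · rw [hupper' h', hmid]
      have : y' ≤ y + i := by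
        by_contra hc
        simp only [crossStair] at hlt
        split_ifs at hlt <;> omega
      have : (y' : ℤ) - y ≤ i := by
        have : (y' : ℤ) ≤ y + i := by exact_mod_cast this
        linarith
      linarith [mul_le_mul_of_nonneg_left this hτ0]
  · rcases hM.eq_or_lt with rfl | h'
    · rw [hupper h, hmid]
      have : M + i + 1 ≤ y := by
        by_contra hc
        simp only [crossStair] at hlt
        split_ifs at hlt <;> omega
      have : (i : ℤ) + 1 ≤ y - M := by
        have : (M : ℤ) + i + 1 ≤ y := by exact_mod_cast this
        linarith
      linarith [mul_le_mul_of_nonneg_left this hτ0]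
    · rw [hupper h, hupper' h']
      have : y' + 1 ≤ y := by
        by_contra hc
        simp only [crossStair] at hlt
        split_ifs at hlt <;> omega
      have : (y' : ℤ) + 1 ≤ y := by exact_mod_cast this
      linarith [mul_le_mul_of_nonneg_left this hτ0]

theorem tight_of_kinkedEnds {k M Q s t : ℕ} (hk : 1 ≤ k) (hM : k * k + 2 * k ≤ M)
    (hQ : k * (k + 1) * k ^ (2 * k) ∣ Q) (hQ0 : 0 < Q)
    (ht : (2 * k + 1) * (k * (Q * k) + k) ≤ k * t)
    (hs : (2 * k + 4) * (k * t) ≤ s) (hs' : k * t + k * (Q * k) ≤ s) (htQ : Q ∣ t)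
    {h : ℕ → ℕ} (hanti : ∀ y y', y ≤ y' → y' < M + k + 1 → h y' ≤ h y)
    (hconst : ∀ y, y ≤ M → h y = h 0) (hH : Q ∣ h 0)
    (hlarge : ∀ y, y < M + k + 1 → kinkedEnds k M s t y + k * (Q * k) ≤ h y)
    (j : ℕ) {z : ℕ} (hz : z + j = k) {g : ℕ → ℕ}
    (hg : ∀ y, y < M + k + 1 →
      kinkedEnds k M s t y ≤ g y ∧ g y ≤ kinkedEnds k M s t y + k * (Q * z))
    (hgM : ∀ y, y < M → g y = kinkedEnds k M s t y)
    (hdvd : ∀ y, M < y → y ≤ M + z → Q ∣ h y - g y)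
    (hcard : Q ∣ (rows (M + k + 1) g h).card) :
    Tight k (rows (M + k + 1) g h) := by
  have hgh : ∀ y, y < M + k + 1 → g y ≤ h y := fun y hy => by
    have h1 := hlarge y hy
    have h2 := (hg y hy).2
    have h3 : k * (Q * z) ≤ k * (Q * k) := Nat.mul_le_mul_left _ (Nat.mul_le_mul_left _ (by omega))
    omega
  have hdlow : ∀ y, y < M → Q ∣ h y - g y := fun y hy => by
    rw [hconst y hy.le, hgM y hy, kinkedEnds, if_pos hy.le]
    exact Nat.dvd_sub hH (htQ.mul_right _)
  induction j generalizing z g with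
  | zero =>
    obtain rfl : z = k := hz
    refine tight_of_exhaust hk (2 * z) (by omega) (fun y y' hy hy' => ?_) (fun y hy => hQ.trans ?_)
      (fun y hy => ?_) (fun y hy => hconst y (by omega))
    · have h1 := hanti y y' hy hy'
      rcases hy.eq_or_lt with rfl | hlt
      · exact le_rfl
      suffices g y ≤ g y' by omega
      rcases lt_trichotomy y M with h2 | rfl | h2
      · rw [hgM y h2]
        refine le_trans ?_ (hg y' hy').1
        simp only [kinkedEnds]
        rw [if_pos h2.le]
        split_ifs with h3
        · exact Nat.mul_le_mul_left _ (by omega)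
        · have h4 : t * (y + z - M) ≤ t * z := Nat.mul_le_mul_left _ (by omega)
          have h5 : s * 1 ≤ s * (y' - M) := Nat.mul_le_mul_left _ (by omega)
          rw [mul_comm t z] at h4
          omega
      · refine (hg y (by omega)).2.trans (le_trans ?_ (hg y' hy').1)
        simp only [kinkedEnds]
        rw [if_pos le_rfl, if_neg (by omega), Nat.add_sub_cancel_left, mul_comm t]
        have h5 : s * 1 ≤ s * (y' - y) := Nat.mul_le_mul_left _ (by omega)
        omega
      · refine (hg y (by omega)).2.trans (le_trans ?_ (hg y' hy').1)
        simp only [kinkedEnds]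
        rw [if_neg (by omega), if_neg (by omega)]
        have h5 : s * (y - M) + s * 1 ≤ s * (y' - M) := by
          rw [← mul_add]
          exact Nat.mul_le_mul_left _ (by omega)
        omega
    · rcases lt_trichotomy y M with h2 | rfl | h2
      · exact hdlow y h2
      · rw [card_rows, ← Finset.add_sum_erase _ _ (Finset.mem_range.mpr hy)] at hcard
        refine (Nat.dvd_add_left (Finset.dvd_sum fun x hx => ?_)).mp hcard
        simp only [Finset.mem_erase, Finset.mem_range] at hx
        rcases lt_or_gt_of_ne hx.1 with h3 | h3
        · exact hdlow x h3
        · exact hdvd x h3 (by omega)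
      · exact hdvd y h2 (by omega)
    · rw [hgM y (by omega), kinkedEnds, if_pos (by omega)]
      rw [show y + z - M = 0 by omega, mul_zero]
  | succ j ih =>
    have hQk : k * (Q * z) + k * Q ≤ k * (Q * k) := by
      rw [← mul_add, ← Nat.mul_succ]
      exact Nat.mul_le_mul_left _ (Nat.mul_le_mul_left _ (by omega))
    set c := (h (M + z + 1) - g (M + z + 1)) % Q with hc
    have hcQ : c < Q := Nat.mod_lt _ hQ0
    have hv₁ : IsStair k (M + k + 1) (crossStair k M (z + 1)) := isStair_crossStair (by omega)
    have hv₂ : IsStair k (M + k + 1) (crossStair k M z) := isStair_crossStair (by omega)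
    have hb : ∀ i i' y, i ≤ c → i' ≤ Q - c →
        i * crossStair k M (z + 1) y + i' * crossStair k M z y ≤ k * Q := by
      intro i i' y hi hi'
      calc _ ≤ c * k + (Q - c) * k :=
            add_le_add (Nat.mul_le_mul hi (hv₁.le y)) (Nat.mul_le_mul hi' (hv₂.le y))
        _ = k * Q := by rw [← add_mul, Nat.add_sub_cancel' hcQ.le, mul_comm]
    have hfit : ∀ y, y < M + k + 1 →
        g y + (c * crossStair k M (z + 1) y + (Q - c) * crossStair k M z y) ≤ h y := fun y hy => by
      have h1 := hlarge y hy
      have h2 := (hg y hy).2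
      have h3 := hb c (Q - c) y le_rfl le_rfl
      omega
    refine Tight.rows_left_iterate hv₁ (2 * (z + 1 : ℕ) + 1)
      ((2 * (z + 1 : ℕ) + 1) * s - 2 * (k * t)) (by omega) c (fun y hy => ?_)
      (fun i hi y y' hy hy' hlt => ?_) ?_
    · have := hfit y hy
      omega
    · have := crossStair_order (g := fun y => g y + i * crossStair k M (z + 1) y) (by omega) ht hs
        (fun y hy => ?_) y y' hy hy' hlt
      · exact_mod_cast this
      · have h2 := hg y hy
        have h3 := hb i 0 y (by omega) (by omega)
        omega
    refine Tight.rows_left_iterate hv₂ (2 * z + 1) ((2 * z + 1) * s - 2 * (k * t)) (by omega)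
      (Q - c) (fun y hy => ?_) (fun i hi y y' hy hy' hlt => ?_) ?_
    · have := hfit y hy
      omega
    · have := crossStair_order
        (g := fun y => g y + c * crossStair k M (z + 1) y + i * crossStair k M z y) (by omega) ht hs
        (fun y hy => ?_) y y' hy hy' hlt
      · exact_mod_cast this
      · have h2 := hg y hy
        have h3 := hb c i y le_rfl (by omega)
        omega
    have hlow : ∀ y, y < M → crossStair k M (z + 1) y = 0 ∧ crossStair k M z y = 0 := fun y hy => by
      simp [crossStair, hy]
    have hgM' : ∀ y, y < M → g y + c * crossStair k M (z + 1) y + (Q - c) * crossStair k M z y =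
        kinkedEnds k M s t y := fun y hy => by
      rw [(hlow y hy).1, (hlow y hy).2, mul_zero, mul_zero, add_zero, add_zero, hgM y hy]
    refine ih (z := z + 1) (by omega) (fun y hy => ?_) hgM' (fun y hy hyz => ?_) ?_
      (fun y hy => ?_) (fun y hy => ?_)
    · have h2 := hg y hy
      have h3 := hb c (Q - c) y le_rfl le_rfl
      rw [mul_add Q, mul_add k, mul_one]
      omega
    · rcases Nat.lt_or_ge y (M + z + 1) with h1 | h1
      · have h2 : crossStair k M (z + 1) y = crossStair k M z y := by
          simp only [crossStair]
          split_ifs <;> omega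
        rw [h2, add_assoc, ← add_mul, Nat.add_sub_cancel' hcQ.le, ← Nat.sub_sub]
        exact Nat.dvd_sub (hdvd y hy (by omega)) (dvd_mul_right _ _)
      · obtain rfl : y = M + z + 1 := by omega
        have h2 : crossStair k M (z + 1) (M + z + 1) = crossStair k M z (M + z + 1) + 1 := by
          simp only [crossStair]
          split_ifs <;> omega
        have h3 : ∀ {c Q : ℕ} (a : ℕ), c ≤ Q → c * (a + 1) + (Q - c) * a = c + Q * a :=
          fun {c Q} a hle => by
            obtain ⟨u, rfl⟩ := Nat.exists_eq_add_of_le hle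
            rw [Nat.add_sub_cancel_left]
            ring
        rw [h2, add_assoc (g _), h3 _ hcQ.le, ← Nat.sub_sub, ← Nat.sub_sub]
        exact Nat.dvd_sub (Nat.dvd_sub_mod _) (dvd_mul_right _ _)
    · have h1 := card_rows_left (u := fun y =>
        c * crossStair k M (z + 1) y + (Q - c) * crossStair k M z y) hfit
      rw [Finset.sum_add_distrib, ← Finset.mul_sum, ← Finset.mul_sum, hv₁.sum, hv₂.sum, ← add_mul,
        Nat.add_sub_cancel' hcQ.le] at h1
      rw [h1] at hcard
      simp only [← add_assoc] at hcard
      exact (Nat.dvd_add_left (dvd_mul_right _ _)).mp hcard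
    · have := hfit y hy
      omega
    · rw [hgM' y hy, ← hgM y hy]
      exact hdlow y hy

/-- Regions with rows of length at least `L`, all but the last `k` of which have the same
sufficiently divisible length, are tight as soon as their cardinality is right. -/
theorem exists_tight_rows {k : ℕ} (hk : 1 ≤ k) :
    ∃ Q L M : ℕ, 0 < Q ∧ ∀ (h : ℕ → ℕ) (n : ℕ),
      (∀ y y', y ≤ y' → y' < M + k + 1 → h y' ≤ h y) → (∀ y, y ≤ M → h y = h 0) →
      Q ∣ h 0 → (∀ y, y < M + k + 1 → L ≤ h y) →
      (rows (M + k + 1) (fun _ => 0) h).card = n * tri k →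
      Tight k (rows (M + k + 1) (fun _ => 0) h) := by
  set M := k * k + 2 * k with hM
  set Q := k * (k + 1) * k ^ (2 * k) with hQ
  have hQ0 : 0 < Q := by positivity
  set t := (2 * k + 1) * (k + 1) * Q with ht
  have ht1 : (2 * k + 1) * (k * (Q * k) + k) ≤ k * t := by
    calc (2 * k + 1) * (k * (Q * k) + k) ≤ (2 * k + 1) * (k * (Q * k) + k * Q) := by
          gcongr
          exact Nat.le_mul_of_pos_right k hQ0
      _ = k * t := by rw [ht]; ring
  set S := (2 * k + 4) * (k * t) + k * (Q * k) + ((t + k) * (k + 1) + t * k + k) with hS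
  refine ⟨Q, (Q * S + Q) * k + k * t + k * (Q * k), M, hQ0,
    fun h n hanti hconst hH hL hcard => ?_⟩
  set s := Q * S + n % Q with hs
  have hSs : S ≤ s := le_trans (Nat.le_mul_of_pos_left S hQ0) (Nat.le_add_right _ _)
  have hsS : s * k ≤ (Q * S + Q) * k :=
    Nat.mul_le_mul_right _ (Nat.add_le_add_left (Nat.mod_lt n hQ0).le _)
  have hkt : k * t ≤ (2 * k + 4) * (k * t) := Nat.le_mul_of_pos_left _ (by omega)
  let v₁ : ℕ → ℕ := fun y => if y ≤ M + k then y - M else 0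
  let v₂ : ℕ → ℕ := fun y => if y ≤ M then y + k - M else 0
  have hv₁ : IsStair k (M + k + 1) v₁ := by
    refine ⟨fun y => ?_, fun y y' => ?_, fun i hi hik => ⟨M + i, ?_⟩, fun y => ?_⟩ <;>
      simp only [v₁] <;> split_ifs <;> omega
  have hv₂ : IsStair k (M + k + 1) v₂ := by
    refine ⟨fun y => ?_, fun y y' => ?_, fun i hi hik => ⟨M + i - k, ?_⟩, fun y => ?_⟩ <;>
      simp only [v₂] <;> split_ifs <;> omega
  have hends : ∀ y, y < M + k + 1 → 0 + s * v₁ y + t * v₂ y = kinkedEnds k M s t y := by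
    intro y hy
    simp only [v₁, v₂, kinkedEnds]
    split_ifs with h1 h2
    · rw [show y - M = 0 by omega]
      simp
    · simp
    · omega
    · omega
  have hfit : ∀ y, y < M + k + 1 → 0 + s * v₁ y + t * v₂ y ≤ (Q * S + Q) * k + k * t := by
    intro y hy
    have h1 := (Nat.mul_le_mul_left s (hv₁.le y)).trans hsS
    have h2 := Nat.mul_le_mul_left t (hv₂.le y)
    rw [mul_comm t k] at h2
    omega
  refine Tight.rows_left_iterate hv₁ 1 (s * k + k) le_rfl s (fun y hy => ?_)
    (fun i hi y y' hy hy' hlt => ?_) ?_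
  · have := hfit y hy
    have := hL y hy
    omega
  · have h1 : y + 1 ≤ y' := by
      by_contra hc
      simp only [v₁] at hlt
      split_ifs at hlt <;> omega
    have h2 : (i : ℤ) * v₁ y' ≤ s * k := by
      exact_mod_cast Nat.mul_le_mul hi.le (hv₁.le y')
    have h3 : (y : ℤ) + 1 ≤ y' := by exact_mod_cast h1
    have h4 : (0 : ℤ) ≤ i * v₁ y := by positivity
    have h5 := mul_le_mul_of_nonneg_left h3 (by positivity : (0 : ℤ) ≤ s * k + k)
    push_cast
    linarith
  refine Tight.rows_left_iterate hv₂ 1 (t + k) le_rfl t (fun y hy => ?_)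
    (fun i hi y y' hy hy' hlt => ?_) ?_
  · have := hfit y hy
    have := hL y hy
    omega
  · have hy'M : y' ≤ M ∧ M < y' + k := by
      simp only [v₂] at hlt
      split_ifs at hlt <;> omega
    have hv1y' : v₁ y' = 0 := by
      simp only [v₁]
      split_ifs <;> omega
    have h2 : (i : ℤ) * v₂ y' ≤ t * k := by
      exact_mod_cast Nat.mul_le_mul hi.le (hv₂.le y')
    have hi0 : (0 : ℤ) ≤ i := by positivity
    have hit : (i : ℤ) ≤ t := by exact_mod_cast hi.le
    rcases Nat.lt_or_ge M y with hyM | hyM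
    · have hv1y : (v₁ y : ℤ) = y - M := by
        simp only [v₁]
        rw [if_pos (by omega), Nat.cast_sub hyM.le]
      have hv2y : v₂ y = 0 := by
        simp only [v₂]
        rw [if_neg (by omega)]
      rw [hv1y', hv2y]
      have h3 : (1 : ℤ) ≤ y - M := by
        have : (M : ℤ) + 1 ≤ y := by exact_mod_cast hyM
        linarith
      have h4 : (M : ℤ) - y' ≤ k := by
        have : (M : ℤ) ≤ y' + k := by exact_mod_cast hy'M.2.le
        linarith
      have h5 : ((t + k) * (k + 1) + t * k + k : ℤ) ≤ s := by
        have : (t + k) * (k + 1) + t * k + k ≤ s := by omega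
        exact_mod_cast this
      have h6 := mul_le_mul_of_nonneg_left h4 (by positivity : (0 : ℤ) ≤ t + k)
      have h7 : (0 : ℤ) ≤ (s - (t + k)) * (y - M - 1) := by
        refine mul_nonneg ?_ (by linarith)
        have : (0 : ℤ) ≤ (t + k) * k + t * k + k := by positivity
        linarith
      push_cast
      rw [hv1y]
      linarith
    · have h1 : y + 1 ≤ y' := by
        by_contra hc
        simp only [v₂] at hlt
        split_ifs at hlt <;> omega
      have h3 : (y : ℤ) + 1 ≤ y' := by exact_mod_cast h1
      have hv1y : v₁ y = 0 := by
        simp only [v₁]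
        split_ifs <;> omega
      have h4 : (v₂ y' : ℤ) ≤ v₂ y + (y' - y) := by
        have : v₂ y' ≤ v₂ y + (y' - y) := by
          simp only [v₂]
          split_ifs <;> omega
        have h5 : ((y' - y : ℕ) : ℤ) = y' - y := Nat.cast_sub (by omega)
        rw [← h5]
        exact_mod_cast this
      rw [hv1y, hv1y']
      have h5 := mul_le_mul_of_nonneg_left h4 hi0
      have h6 := mul_le_mul_of_nonneg_right hit (by linarith : (0 : ℤ) ≤ y' - y)
      have h7 := mul_le_mul_of_nonneg_left (by linarith : (1 : ℤ) ≤ y' - y)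
        (by positivity : (0 : ℤ) ≤ k)
      push_cast
      linarith
  have hnst : (rows (M + k + 1) (fun y => 0 + s * v₁ y + t * v₂ y) h).card + (s + t) * tri k =
      n * tri k := by
    have hsum : ∑ y ∈ Finset.range (M + k + 1), (s * v₁ y + t * v₂ y) = (s + t) * tri k := by
      rw [Finset.sum_add_distrib, ← Finset.mul_sum, ← Finset.mul_sum, hv₁.sum, hv₂.sum, ← add_mul]
    rw [← hcard, ← hsum]
    simp only [add_assoc (0 : ℕ)]
    refine (card_rows_left fun y hy => ?_).symm
    have := hfit y hy
    have := hL y hy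
    omega
  refine tight_of_kinkedEnds (s := s) (t := t) (Q := Q) hk le_rfl dvd_rfl hQ0 ht1 (by omega)
    (by omega) (dvd_mul_left _ _) hanti hconst hH (fun y hy => ?_) k (zero_add k) (fun y hy => ?_)
    (fun y hy => hends y (by omega)) (fun y hy hy' => by omega) ?_
  · rw [← hends y hy]
    have := hfit y hy
    have := hL y hy
    omega
  · rw [hends y hy]
    exact ⟨le_rfl, le_rfl⟩
  · have hQn : Q ∣ n - (s + t) := by
      have h1 : n - (s + t) = Q * (n / Q) - Q * (S + (2 * k + 1) * (k + 1)) := by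
        have h2 := Nat.div_add_mod n Q
        have h3 : Q * (S + (2 * k + 1) * (k + 1)) = Q * S + t := by rw [ht]; ring
        omega
      rw [h1]
      exact Nat.dvd_sub (dvd_mul_right _ _) (dvd_mul_right _ _)
    have h1 : (rows (M + k + 1) (fun y => 0 + s * v₁ y + t * v₂ y) h).card =
        (n - (s + t)) * tri k := by
      rw [Nat.sub_mul]
      omega
    rw [h1]
    exact hQn.mul_right _

/-- Assign the values in `A` to the last rows of a diagram: a row takes its own length if
available and the largest available value otherwise. -/
theorem exists_assignment {ℓ : ℕ → ℕ} (A : Finset ℕ) (T : ℕ) (hT : A.card ≤ T)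
    (hA : ∀ a ∈ A, 1 ≤ a)
    (hℓ : ∀ y y', y < y' → y' < T → ℓ y' ≤ ℓ y ∧ (ℓ y ∈ A → ℓ y' < ℓ y))
    (hlong : ∀ y, y < T → ℓ y ∈ A ∨ ∀ a ∈ A, a < ℓ y) :
    ∃ v : ℕ → ℕ, (∀ y, T ≤ y → v y = 0) ∧ (∀ y, y + A.card < T → v y = 0) ∧
      (∀ y, v y = 0 ∨ v y ∈ A) ∧ (∀ y y', v y ≠ 0 → v y = v y' → y = y') ∧
      (∀ a ∈ A, ∃ y, v y = a) ∧ (∀ y, v y ≤ ℓ y) ∧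
      ∀ y' y, y' < y → y < T → 1 ≤ v y' → v y = ℓ y ∨ v y' < v y := by
  induction T generalizing A with
  | zero =>
    obtain rfl : A = ∅ := Finset.card_eq_zero.mp (by omega)
    exact ⟨fun _ => 0, by simp⟩
  | succ T ih =>
    rcases A.eq_empty_or_nonempty with rfl | hne
    · exact ⟨fun _ => 0, by simp⟩
    obtain ⟨b, hbA, hbℓ, hb⟩ : ∃ b ∈ A, b ≤ ℓ T ∧ (b = ℓ T ∨ ((∀ a ∈ A, a ≤ b) ∧ b < ℓ T)) := by
      rcases hlong T (Nat.lt_succ_self T) with h | h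
      · exact ⟨ℓ T, h, le_rfl, Or.inl rfl⟩
      · have h1 := h _ (A.max'_mem hne)
        exact ⟨A.max' hne, A.max'_mem hne, h1.le, Or.inr ⟨fun a ha => A.le_max' a ha, h1⟩⟩
    have hcard := Finset.card_erase_of_mem hbA
    have hpos := Finset.card_pos.mpr hne
    obtain ⟨v, h1, h2, h3, h4, h5, h6, h7⟩ := ih (A.erase b) (by omega)
      (fun a ha => hA a (Finset.mem_of_mem_erase ha))
      (fun y y' hy hy' => ⟨(hℓ y y' hy (by omega)).1,
        fun h => (hℓ y y' hy (by omega)).2 (Finset.mem_of_mem_erase h)⟩)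
      (fun y hy => by
        rcases hlong y (by omega) with h | h
        · refine Or.inl (Finset.mem_erase.mpr ⟨fun hyb => ?_, h⟩)
          have h8 := (hℓ y T hy (Nat.lt_succ_self T)).2 h
          omega
        · exact Or.inr fun a ha => h a (Finset.mem_of_mem_erase ha))
    have hb1 := hA b hbA
    have h3' : ∀ y, v y = 0 ∨ (v y ≠ b ∧ v y ∈ A) := fun y => by
      simpa [Finset.mem_erase] using h3 y
    have hvT := h1 T le_rfl
    refine ⟨fun y => if y = T then b else v y, fun y hy => ?_, fun y hy => ?_, fun y => ?_,
      fun y y' => ?_, fun a ha => ?_, fun y => ?_, fun y' y hlt hy => ?_⟩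
    · dsimp only
      rw [if_neg (by omega)]
      exact h1 y (by omega)
    · dsimp only
      rw [if_neg (by omega)]
      exact h2 y (by omega)
    · dsimp only
      split_ifs
      · exact Or.inr hbA
      · exact (h3' y).imp_right And.right
    · dsimp only
      have := h3' y
      have := h3' y'
      have := h4 y y'
      split_ifs <;> omega
    · by_cases hab : a = b
      · exact ⟨T, by simp [hab]⟩
      · obtain ⟨y, hy⟩ := h5 a (Finset.mem_erase.mpr ⟨hab, ha⟩)
        refine ⟨y, ?_⟩
        dsimp only
        rw [if_neg, hy]
        rintro rfl
        have := hA a ha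
        omega
    · dsimp only
      split_ifs with h
      · rwa [h]
      · exact h6 y
    · dsimp only
      rw [if_neg (by omega : ¬ y' = T)]
      intro hv
      split_ifs with h
      · subst h
        refine hb.imp_right fun hb => ?_
        rcases h3' y' with h8 | h8
        · omega
        · exact lt_of_le_of_ne (hb.1 _ h8.2) h8.1
      · exact h7 y' y hlt (by omega) hv

/-- `ℓ` is a diagram obtained from `ℓ₀` by removing points of multiplicity at most `m` from the
last rows, as long as there are more than `Y` rows. -/
structure Eroded (m Y : ℕ) (ℓ₀ ℓ : ℕ → ℕ) : Prop where
  succ_le : ∀ y, ℓ (y + 1) ≤ ℓ y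
  strict : ∀ y, 0 < ℓ (y + 1) → ℓ (y + 1) ≤ m → ℓ (y + 1) < ℓ y
  le : ∀ y, ℓ y ≤ ℓ₀ y
  eq : ∀ y, y + m ≤ Y → ℓ y = ℓ₀ y
  slope : ∀ y, 0 < ℓ (y + 1) → m * ℓ₀ y + (m - 1) * ℓ (y + 1) ≤ m * ℓ y + (m - 1) * ℓ₀ (y + 1)
  last : ∀ y, y + 1 = Y → m * ℓ₀ y ≤ m * ℓ y + (m - 1) * ℓ₀ Y + m * m

theorem Eroded.refl {m Y : ℕ} {ℓ : ℕ → ℕ} (h : ∀ y, ℓ (y + 1) ≤ ℓ y)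
    (h' : ∀ y, 0 < ℓ (y + 1) → ℓ (y + 1) ≤ m → ℓ (y + 1) < ℓ y) : Eroded m Y ℓ ℓ :=
  ⟨h, h', fun _ => le_rfl, fun _ _ => rfl, fun _ _ => le_rfl,
    fun _ _ => (Nat.le_add_right _ _).trans (Nat.le_add_right _ _)⟩

theorem Eroded.exists_step {m Y n k : ℕ} {ℓ₀ ℓ : ℕ → ℕ} (h : Eroded m Y ℓ₀ ℓ) (hmY : m ≤ Y)
    (hn : ∀ y, n ≤ y → ℓ₀ y = 0) (hY : 0 < ℓ Y) (hk : k ≤ m) :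
    ∃ v : ℕ → ℕ, IsStair k n v ∧ (∀ y, v y ≤ ℓ y) ∧
      (∀ y' y, y' < y → 1 ≤ v y' → v y = ℓ y ∨ v y' < v y) ∧
      Eroded m Y ℓ₀ fun y => ℓ y - v y := by
  classical
  have hanti := antitone_nat_of_succ_le h.succ_le
  have hex : ∃ T, ℓ T = 0 := ⟨n, Nat.le_zero.mp ((h.le n).trans (hn n le_rfl).le)⟩
  obtain ⟨T, hT⟩ : ∃ T, ∀ y, y < T ↔ 0 < ℓ y := by
    refine ⟨Nat.find hex, fun y => ⟨fun hy => Nat.pos_of_ne_zero (Nat.find_min hex hy),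
      fun hy => ?_⟩⟩
    by_contra hc
    have h1 := hanti (not_lt.mp hc)
    have h2 := Nat.find_spec hex
    omega
  have hYT := (hT Y).mpr hY
  have hTn : T ≤ n := by
    by_contra hc
    have h1 := (hT n).mp (by omega)
    have h2 := h.le n
    have h3 := hn n le_rfl
    omega
  obtain ⟨v, h1, h2, h3, h4, h5, h6, h7⟩ := exists_assignment (ℓ := ℓ) (Finset.Icc 1 k) T
    (by rw [Nat.card_Icc]; omega) (fun a ha => (Finset.mem_Icc.mp ha).1)
    (fun y y' hy hy' => ⟨hanti hy.le, fun hA => by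
      have h8 := h.strict y ((hT (y + 1)).mp (by omega))
      have h9 := hanti (show y + 1 ≤ y' by omega)
      have h10 := h.succ_le y
      rw [Finset.mem_Icc] at hA
      omega⟩)
    (fun y hy => by
      have h8 := (hT y).mp hy
      rcases Nat.lt_or_ge k (ℓ y) with h9 | h9
      · exact Or.inr fun a ha => (Finset.mem_Icc.mp ha).2.trans_lt h9
      · exact Or.inl (Finset.mem_Icc.mpr ⟨h8, h9⟩))
  rw [Nat.card_Icc, Nat.add_sub_cancel] at h2
  have hle : ∀ y, v y ≤ k := fun y => by
    have := h3 y
    rw [Finset.mem_Icc] at this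
    omega
  have hord : ∀ y' y, y' < y → 1 ≤ v y' → v y = ℓ y ∨ v y' < v y := by
    intro y' y hlt hv
    rcases Nat.lt_or_ge y T with hy | hy
    · exact h7 y' y hlt hy hv
    · have h8 := h6 y
      have h9 := hT y
      omega
  refine ⟨v, ⟨hle, h4, fun j hj hjk => h5 j (Finset.mem_Icc.mpr ⟨hj, hjk⟩),
    fun y hy => h1 y (by omega)⟩, h6, hord, fun y => ?_, fun y => ?_, fun y => ?_, fun y hy => ?_,
    fun y hpos => ?_, fun y hy => ?_⟩
  · have := hord y (y + 1) (by omega)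
    have := h.succ_le y
    have := h6 y
    omega
  · have := hord y (y + 1) (by omega)
    have := h.succ_le y
    have := h.strict y
    have := h6 y
    omega
  · exact (Nat.sub_le _ _).trans (h.le y)
  · rw [h2 y (by omega), h.eq y hy, Nat.sub_zero]
  · have h8 := h.slope y (by omega)
    have h9 := hord y (y + 1) (by omega)
    have h10 := h6 y
    have h11 := h6 (y + 1)
    have h12 : m * v y ≤ (m - 1) * v (y + 1) := by
      rcases Nat.eq_zero_or_pos (v y) with h0 | h0
      · simp [h0]
      · have h13 : v y + 1 ≤ v (y + 1) := by omega
        have h14 := (hle (y + 1)).trans hk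
        have h15 := Nat.mul_le_mul_left m h13
        rw [Nat.sub_mul, one_mul]
        rw [mul_add, mul_one] at h15
        omega
    simp only [Nat.mul_sub]
    have h13 := Nat.mul_le_mul_left m h10
    have h14 := Nat.mul_le_mul_left (m - 1) h11
    omega
  · subst hy
    have h8 := h.slope y hY
    have h9 := Nat.mul_le_mul_left m ((hle y).trans hk)
    simp only [Nat.mul_sub]
    omega

/-- Removing points from the last rows reduces nonspeciality of a diagram to that of a diagram
with at most `Y` rows. -/
theorem Eroded.nonSpecial {m Y n : ℕ} {ℓ₀ : ℕ → ℕ} (hmY : m ≤ Y) (hYn : Y < n)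
    (hn : ∀ y, n ≤ y → ℓ₀ y = 0) (L : List ℕ) (hL : ∀ k ∈ L, k ≤ m) (ℓ : ℕ → ℕ)
    (h : Eroded m Y ℓ₀ ℓ) (hcard : (rows n (fun _ => 0) ℓ).card = (L.map tri).sum)
    (hend : ∀ (ℓ' : ℕ → ℕ) (L' : List ℕ), Eroded m Y ℓ₀ ℓ' → ℓ' Y = 0 → L' <:+ L →
      (rows n (fun _ => 0) ℓ').card = (L'.map tri).sum →
      NonSpecial (rows n (fun _ => 0) ℓ') L') :
    NonSpecial (rows n (fun _ => 0) ℓ) L := by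
  induction L generalizing ℓ with
  | nil =>
    refine hend ℓ [] h ?_ List.suffix_rfl hcard
    by_contra hc
    have : (0, Y) ∈ rows n (fun _ => 0) ℓ := mem_rows.mpr ⟨hYn, le_rfl, Nat.pos_of_ne_zero hc⟩
    rw [List.map_nil, List.sum_nil, Finset.card_eq_zero] at hcard
    simp [hcard] at this
  | cons k L ih =>
    rcases Nat.eq_zero_or_pos (ℓ Y) with hY | hY
    · exact hend ℓ _ h hY List.suffix_rfl hcard
    obtain ⟨v, hv, hvℓ, hord, h'⟩ := h.exists_step hmY hn hY (hL k List.mem_cons_self)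
    rw [← Multiset.cons_coe]
    refine nonSpecial_rows_right hv hvℓ (fun y y' hne _ hv' hlt hle => ?_)
      (ih (fun k' hk' => hL k' (List.mem_cons_of_mem _ hk')) _ h' ?_
        fun ℓ' L' h1 h2 h3 h4 => hend ℓ' L' h1 h2 (h3.trans (List.suffix_cons k L)) h4)
    · by_contra hc
      have := hord y' y (by omega) hv'
      omega
    · rw [List.map_cons, List.sum_cons, ← hv.sum] at hcard
      have h1 : (rows n (fun _ => 0) ℓ).card =
          (rows n (fun _ => 0) fun y => ℓ y - v y).card + ∑ y ∈ Finset.range n, v y := by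
        rw [card_rows, card_rows, ← Finset.sum_add_distrib]
        refine Finset.sum_congr rfl fun y _ => ?_
        have := hvℓ y
        omega
      omega

theorem tri_pos {k : ℕ} (hk : 1 ≤ k) : 0 < tri k := by
  have := two_mul_tri k
  have : 0 < k * (k + 1) := by positivity
  omega

theorem tri_mono {j k : ℕ} (h : j ≤ k) : tri j ≤ tri k :=
  Nat.div_le_div_right (Nat.mul_le_mul h (Nat.succ_le_succ h))

/-- Nonspeciality of diagrams whose first rows are long and of equal length, for points of equal
multiplicity. -/
theorem exists_nonSpecial_replicate {k : ℕ} (hk : 1 ≤ k) :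
    ∃ Q W C : ℕ, 0 < Q ∧ ∀ (H n N : ℕ) (ℓ : ℕ → ℕ), Q ∣ H → C ≤ H → W < n →
      (∀ y, ℓ (y + 1) ≤ ℓ y) → (∀ y, 0 < ℓ (y + 1) → ℓ (y + 1) ≤ k → ℓ (y + 1) < ℓ y) →
      (∀ y, y < W → ℓ y = H) → (∀ y, n ≤ y → ℓ y = 0) →
      (rows n (fun _ => 0) ℓ).card = N * tri k →
      NonSpecial (rows n (fun _ => 0) ℓ) (Multiset.replicate N k) := by
  obtain ⟨Q, L, M, hQ, hrows⟩ := exists_tight_rows hk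
  refine ⟨Q, M + k + 1, k * L + k * k, hQ,
    fun H n N ℓ hQH hH hW hsucc hstrict hconst hzero hcard => ?_⟩
  rw [← Multiset.coe_replicate]
  refine Eroded.nonSpecial (m := k) (Y := M + k + 1) (by omega) hW hzero _
    (fun j hj => (List.eq_of_mem_replicate hj).le) ℓ (Eroded.refl hsucc hstrict) (by simpa) ?_
  intro ℓ' L' h hY hL' hcard'
  obtain ⟨N', rfl⟩ : ∃ N', L' = List.replicate N' k :=
    ⟨_, List.eq_replicate_of_mem fun j hj => List.eq_of_mem_replicate (hL'.subset hj)⟩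
  have hanti := antitone_nat_of_succ_le h.succ_le
  have hrw : rows n (fun _ => 0) ℓ' = rows (M + k + 1) (fun _ => 0) ℓ' := by
    ext e
    rw [mem_rows, mem_rows]
    have : M + k + 1 ≤ e.2 → ℓ' e.2 ≤ ℓ' (M + k + 1) := fun h => hanti h
    omega
  have hfirst : ∀ y, y ≤ M → ℓ' y = H := fun y hy => by
    rw [h.eq y (by omega), hconst y (by omega)]
  have hlast : L ≤ ℓ' (M + k) := by
    have h1 := h.last (M + k) rfl
    rw [hconst (M + k) (by omega)] at h1
    have h2 : ℓ (M + k + 1) ≤ H := (hsucc _).trans (hconst (M + k) (by omega)).le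
    have h3 := Nat.mul_le_mul_left (k - 1) h2
    have h4 : (k - 1) * H + H = k * H := by
      rw [← Nat.succ_mul, Nat.succ_eq_add_one, Nat.sub_add_cancel hk]
    exact Nat.le_of_mul_le_mul_left (by omega) hk
  rw [hrw, List.map_replicate, List.sum_replicate, smul_eq_mul] at hcard'
  rw [hrw]
  obtain ⟨n', hn', h'⟩ := hrows ℓ' N' (fun y y' hy _ => hanti hy)
    (fun y hy => by rw [hfirst y hy, hfirst 0 (Nat.zero_le M)])
    (by rwa [hfirst 0 (Nat.zero_le M)])
    (fun y hy => hlast.trans (hanti (by omega))) hcard'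
  rw [hcard'] at hn'
  rwa [Multiset.coe_replicate, Nat.eq_of_mul_eq_mul_right (tri_pos hk) hn']

/-- The conjugate of a diagram with finitely many rows. -/
theorem exists_conjugate {ℓ : ℕ → ℕ} (hℓ : Antitone ℓ) {H : ℕ} (hH : ℓ H = 0) :
    ∃ ℓ' : ℕ → ℕ, ∀ x y, y < ℓ' x ↔ x < ℓ y := by
  classical
  have hex : ∀ x, ∃ y, ℓ y ≤ x := fun x => ⟨H, by omega⟩
  refine ⟨fun x => Nat.find (hex x), fun x y => ⟨fun h => ?_, fun h => ?_⟩⟩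
  · exact not_le.mp (Nat.find_min (hex x) h)
  · by_contra hc
    exact absurd ((hℓ (not_lt.mp hc)).trans (Nat.find_spec (hex x))) (not_le.mpr h)

theorem exists_nonSpecial_diagram (m : ℕ) (hm : 1 ≤ m) :
    ∃ H D : ℕ, 1 ≤ H ∧ ∀ (d N k : ℕ) (L : List ℕ) (ℓ₀ : ℕ → ℕ), D ≤ d → (∀ j ∈ L, j ≤ m) →
      1 ≤ k → k ≤ m → H * (d + 1) < N * tri k →
      (∀ y, ℓ₀ (y + 1) ≤ ℓ₀ y) → (∀ y, 0 < ℓ₀ (y + 1) → ℓ₀ (y + 1) ≤ m → ℓ₀ (y + 1) < ℓ₀ y) →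
      (∀ y, y ≤ H → ℓ₀ y = d + 1 - y) → (∀ y, d + 1 ≤ y → ℓ₀ y = 0) →
      (rows (d + 1) (fun _ => 0) ℓ₀).card = ((L ++ List.replicate N k).map tri).sum →
      NonSpecial (rows (d + 1) (fun _ => 0) ℓ₀)
        ((L ++ List.replicate N k : List ℕ) : Multiset ℕ) := by
  choose! Q W C hQ hrep using fun k (hk : 1 ≤ k) => exists_nonSpecial_replicate hk
  set H := (∏ k ∈ Finset.Icc 1 m, Q k) * (2 * m + ∑ k ∈ Finset.Icc 1 m, C k) with hH
  have hprod : 0 < ∏ k ∈ Finset.Icc 1 m, Q k :=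
    Finset.prod_pos fun k hk => hQ k (Finset.mem_Icc.mp hk).1
  have hHle : 2 * m + ∑ k ∈ Finset.Icc 1 m, C k ≤ H := Nat.le_mul_of_pos_left _ hprod
  set W' := ∑ k ∈ Finset.Icc 1 m, W k with hW'
  refine ⟨H, H + m * m + m * W' + W', by omega, ?_⟩
  intro d N k L ℓ₀ hd hL hk hkm hN hsucc hstrict htop hzero hcard
  have hkmem : k ∈ Finset.Icc 1 m := Finset.mem_Icc.mpr ⟨hk, hkm⟩
  have hWk : W k ≤ W' := Finset.single_le_sum (f := W) (fun _ _ => Nat.zero_le _) hkmem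
  have hCk : C k ≤ ∑ k ∈ Finset.Icc 1 m, C k :=
    Finset.single_le_sum (f := C) (fun _ _ => Nat.zero_le _) hkmem
  refine Eroded.nonSpecial (m := m) (Y := H) (by omega) (by omega) hzero _ (fun j hj => ?_) ℓ₀
    (Eroded.refl hsucc hstrict) hcard ?_
  · rcases List.mem_append.mp hj with h | h
    · exact hL j h
    · exact (List.eq_of_mem_replicate h).trans_le hkm
  intro ℓ L' h hY hL' hcard'
  have hanti := antitone_nat_of_succ_le h.succ_le
  have hℓ0 : ℓ 0 = d + 1 := by rw [h.eq 0 (by omega), htop 0 (by omega), Nat.sub_zero]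
  obtain ⟨ℓ', hℓ'⟩ := exists_conjugate hanti hY
  have hrows : rows (d + 1) (fun _ => 0) ℓ =
      (rows (d + 1) (fun _ => 0) ℓ').image Prod.swap := by
    ext ⟨x, y⟩
    simp only [Finset.mem_image, Prod.exists, Prod.swap_prod_mk, Prod.mk.injEq, mem_rows]
    have h1 := hℓ' x y
    have h2 := hanti (Nat.zero_le y)
    have h3 := hzero y
    have h4 := h.le y
    constructor
    · intro h5
      exact ⟨y, x, by omega, rfl, rfl⟩
    · rintro ⟨_, _, h5, rfl, rfl⟩
      omega
  obtain ⟨N', rfl⟩ : ∃ N', L' = List.replicate N' k := by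
    rcases List.suffix_or_suffix_of_suffix hL' (List.suffix_append L _) with h1 | h1
    · exact ⟨_, List.eq_replicate_of_mem fun j hj => List.eq_of_mem_replicate (h1.subset hj)⟩
    · exfalso
      obtain ⟨L₁, rfl⟩ := h1
      rw [List.map_append, List.sum_append, List.map_replicate, List.sum_replicate, smul_eq_mul,
        card_rows] at hcard'
      have h2 : ∑ y ∈ Finset.range (d + 1), (ℓ y - 0) ≤ H * (d + 1) := by
        rw [← Finset.sum_subset (Finset.range_subset_range.mpr (by omega : H ≤ d + 1))
          fun y _ hy => ?_]
        · refine (Finset.sum_le_card_nsmul _ _ (d + 1) fun y _ => ?_).trans_eq (by simp)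
          have := hanti (Nat.zero_le y)
          omega
        · have := hanti (not_lt.mp (Finset.mem_range.not.mp hy))
          omega
      omega
  rw [hrows, Multiset.coe_replicate]
  have hlast : W' ≤ ℓ (H - 1) := by
    have h1 := h.last (H - 1) (by omega)
    rw [htop (H - 1) (by omega), htop H le_rfl, show d + 1 - (H - 1) = d + 1 - H + 1 by omega] at h1
    have h2 : (m - 1) * (d + 1 - H) + (d + 1 - H) = m * (d + 1 - H) := by
      rw [← Nat.succ_mul, Nat.succ_eq_add_one, Nat.sub_add_cancel hm]
    rw [mul_add] at h1
    exact Nat.le_of_mul_le_mul_left (by omega) hm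
  have hle : ∀ x, ℓ' x ≤ H := fun x => by
    by_contra hc
    have := (hℓ' x H).mp (not_le.mp hc)
    omega
  refine NonSpecial.swap (hrep k hk H (d + 1) N' ℓ' ?_ (by omega) (by omega) (fun x => ?_)
    (fun x hpos hxk => ?_) (fun x hx => ?_) (fun x hx => ?_) ?_)
  · exact (Finset.dvd_prod_of_mem Q hkmem).mul_right _
  · by_contra hc
    have h1 := (hℓ' (x + 1) (ℓ' x)).mp (not_le.mp hc)
    have h2 := hℓ' x (ℓ' x)
    omega
  · obtain ⟨c, hc⟩ : ∃ c, ℓ' (x + 1) = c + 1 := ⟨ℓ' (x + 1) - 1, by omega⟩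
    have h1 := (hℓ' (x + 1) c).mp (by omega)
    rw [hc]
    refine (hℓ' x (c + 1)).mpr ?_
    rw [h.eq c (by omega), htop c (by omega)] at h1
    rw [h.eq (c + 1) (by omega), htop (c + 1) (by omega)]
    omega
  · have h1 := (hℓ' x (H - 1)).mpr (by omega)
    have h2 := hle x
    omega
  · have := hℓ' x 0
    omega
  · rw [hrows, Finset.card_image_of_injective _ Prod.swap_injective] at hcard'
    simpa using hcard'

/-- A multiset of multiplicities can be reduced to one whose total number of conditions is only
slightly larger than a given number. -/
theorem exists_le_sum_tri {m t : ℕ} (ms : Multiset ℕ) (hms : ∀ k ∈ ms, k ≤ m)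
    (ht : t ≤ (ms.map tri).sum) :
    ∃ ms' ≤ ms, t ≤ (ms'.map tri).sum ∧ (ms'.map tri).sum ≤ t + tri m := by
  induction ms using Multiset.induction with
  | empty => exact ⟨0, le_rfl, ht, by simp⟩
  | cons k s ih =>
    rcases le_total t (s.map tri).sum with h | h
    · obtain ⟨ms', h1, h2⟩ := ih (fun j hj => hms j (Multiset.mem_cons_of_mem hj)) h
      exact ⟨ms', h1.trans (Multiset.le_cons_self s k), h2⟩
    · refine ⟨_, le_rfl, ht, ?_⟩
      rw [Multiset.map_cons, Multiset.sum_cons]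
      have := tri_mono (hms k (Multiset.mem_cons_self k s))
      omega

theorem exists_count_mul_tri {m : ℕ} (hm : 1 ≤ m) (ms : Multiset ℕ)
    (hms : ∀ k ∈ ms, 1 ≤ k ∧ k ≤ m) :
    ∃ k, 1 ≤ k ∧ k ≤ m ∧ (ms.map tri).sum ≤ m * (ms.count k * tri k) := by
  have h1 : (ms.map tri).sum = ∑ k ∈ Finset.Icc 1 m, ms.count k * tri k := by
    rw [Finset.sum_multiset_map_count]
    refine Finset.sum_subset (fun k hk => ?_) fun k _ hk => ?_
    · exact Finset.mem_Icc.mpr (hms k (Multiset.mem_toFinset.mp hk))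
    · rw [Multiset.mem_toFinset, ← Multiset.count_eq_zero] at hk
      simp [hk]
  obtain ⟨k, hk, hmax⟩ := Finset.exists_max_image (Finset.Icc 1 m) (fun k => ms.count k * tri k)
    ⟨1, Finset.mem_Icc.mpr ⟨le_rfl, hm⟩⟩
  refine ⟨k, (Finset.mem_Icc.mp hk).1, (Finset.mem_Icc.mp hk).2, ?_⟩
  rw [h1]
  simpa using Finset.sum_le_card_nsmul _ _ _ hmax

/-- The exponents of the monomials of degree at most `d`. -/
def triangle (d : ℕ) : Finset (ℕ × ℕ) := rows (d + 1) (fun _ => 0) fun y => d + 1 - y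

theorem mem_triangle {d : ℕ} {e : ℕ × ℕ} : e ∈ triangle d ↔ e.1 + e.2 ≤ d := by
  rw [triangle, mem_rows]
  omega

theorem card_triangle (d : ℕ) : (triangle d).card = tri (d + 1) := by
  rw [triangle, card_rows]
  have h : ∀ n, ∑ y ∈ Finset.range n, (n - y - 0) = tri n := by
    intro n
    induction n with
    | zero => rfl
    | succ n ih =>
      rw [Finset.sum_range_succ', Finset.sum_congr rfl fun y _ => by rw [Nat.add_sub_add_right], ih]
      have h1 := two_mul_tri n
      have h2 := two_mul_tri (n + 1)
      have h3 : (n + 1) * (n + 1 + 1) = n * (n + 1) + 2 * (n + 1) := by ring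
      omega
  exact h (d + 1)

theorem exists_nonSpecial_triangle (m : ℕ) (hm : 1 ≤ m) :
    ∃ D : ℕ, ∀ d, D ≤ d → ∀ ms : Multiset ℕ, (∀ k ∈ ms, 1 ≤ k ∧ k ≤ m) →
      tri (d + 1) ≤ (ms.map tri).sum → NonSpecial (triangle d) ms := by
  obtain ⟨H, D, hH, hdiag⟩ := exists_nonSpecial_diagram m hm
  refine ⟨D + 2 * (m * H) + H + tri m + m + 1, fun d hd ms hms hsum => ?_⟩
  obtain ⟨ms', hle, h1, h2⟩ := exists_le_sum_tri ms (fun k hk => (hms k hk).2) hsum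
  have hms' : ∀ k ∈ ms', 1 ≤ k ∧ k ≤ m := fun k hk => hms k (Multiset.mem_of_le hle hk)
  refine NonSpecial.mono_right ?_ hle
  obtain ⟨k, hk, hkm, hcount⟩ := exists_count_mul_tri hm ms' hms'
  obtain ⟨N, hN⟩ := Nat.exists_eq_add_of_le h1
  have hms'' : ms' =
      ((ms'.filter (· ≠ k)).toList ++ List.replicate (ms'.count k) k : List ℕ) := by
    rw [← Multiset.coe_add, Multiset.coe_toList, Multiset.coe_replicate, ← Multiset.filter_eq',
      add_comm, Multiset.filter_add_not]
  set ℓ : ℕ → ℕ := fun y => d + 1 - y + if H + 1 ≤ y ∧ y < H + 1 + N then 1 else 0 with hℓ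
  have hsub : triangle d ⊆ rows (d + 1) (fun _ => 0) ℓ := fun e he => by
    rw [triangle, mem_rows] at he
    rw [mem_rows]
    exact ⟨he.1, he.2.1, he.2.2.trans_le (Nat.le_add_right _ _)⟩
  refine NonSpecial.mono ?_ hsub
  have hcard : (rows (d + 1) (fun _ => 0) ℓ).card = (ms'.map tri).sum := by
    rw [hN, ← card_triangle, triangle, card_rows, card_rows]
    simp only [hℓ, Nat.sub_zero]
    rw [Finset.sum_add_distrib, ← Finset.sum_filter, Finset.sum_const, smul_eq_mul, mul_one]
    congr 1
    have hIco : (Finset.range (d + 1)).filter (fun y => H + 1 ≤ y ∧ y < H + 1 + N) =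
        Finset.Ico (H + 1) (H + 1 + N) := by
      ext y
      simp only [Finset.mem_filter, Finset.mem_range, Finset.mem_Ico]
      omega
    rw [hIco, Nat.card_Ico, Nat.add_sub_cancel_left]
  rw [hms'']
  refine hdiag d _ k _ ℓ (by omega) (fun j hj => ?_) hk hkm ?_ (fun y => ?_) (fun y => ?_)
    (fun y hy => ?_) (fun y hy => ?_) ?_
  · rw [Multiset.mem_toList] at hj
    exact (hms' j (Multiset.mem_of_mem_filter hj)).2
  · have h3 := two_mul_tri (d + 1)
    have h4 : (d + 1) * (2 * (m * H) + 1) ≤ (d + 1) * (d + 1 + 1) :=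
      Nat.mul_le_mul_left _ (by omega)
    have h5 : (d + 1) * (2 * (m * H) + 1) = 2 * (m * (H * (d + 1))) + (d + 1) := by ring
    exact Nat.lt_of_mul_lt_mul_left (a := m) (by omega)
  · simp only [hℓ]
    split_ifs <;> omega
  · simp only [hℓ]
    split_ifs <;> omega
  · simp only [hℓ]
    split_ifs <;> omega
  · simp only [hℓ]
    split_ifs <;> omega
  · rw [hcard]
    conv_lhs => rw [hms'']
    rw [Multiset.map_coe, Multiset.sum_coe]

theorem Multiset.exists_eq_map_pair {ι α : Type*} [DecidableEq ι] [DecidableEq α] [Inhabited α]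
    (s : Finset ι) (f : ι → ℕ) (Q : Multiset (α × ℕ)) (hQ : Q.map Prod.snd = s.val.map f) :
    ∃ w : ι → α, Q = s.val.map fun i => (w i, f i) := by
  induction s using Finset.induction generalizing Q with
  | empty => exact ⟨fun _ => default, by simpa using hQ⟩
  | insert i s hi ih =>
    rw [Finset.insert_val_of_notMem hi, Multiset.map_cons, ← Multiset.map_eq_cons] at hQ
    obtain ⟨P, hP, hPi, hQ⟩ := hQ
    obtain ⟨w, hw⟩ := ih _ hQ
    refine ⟨Function.update w i P.1, ?_⟩
    rw [Finset.insert_val_of_notMem hi, Multiset.map_cons, Function.update_self, ← hPi,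
      ← Multiset.cons_erase hP, hw]
    congr 1
    refine Multiset.map_congr rfl fun j hj => ?_
    rw [Function.update_of_ne]
    rintro rfl
    exact hi hj

/-- Torus points at which points of the given multiplicities impose enough conditions on forms of
degree `d` to exclude all nonzero forms. -/
theorem exists_torus_points {m d : ℕ} {ι : Type*} [Fintype ι] {f : ι → ℕ}
    (hd : ∀ ms : Multiset ℕ, (∀ k ∈ ms, 1 ≤ k ∧ k ≤ m) → tri (d + 1) ≤ (ms.map tri).sum →
      NonSpecial (triangle d) ms)
    (hf : ∀ i, 1 ≤ f i ∧ f i ≤ m) (hsum : tri (d + 1) ≤ ∑ i, tri (f i)) :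
    ∃ w : ι → ℂˣ × ℂˣ, ∀ a : triangle d → ℂ,
      (∀ i p q, p + q < f i → ∑ e : triangle d, a e *
        ((e.1.1 : ℂ) ^ p * (e.1.2 : ℂ) ^ q * (((w i).1 : ℂ) ^ e.1.1 * ((w i).2 : ℂ) ^ e.1.2)) = 0) →
      a = 0 := by
  classical
  obtain ⟨Q, hQ, hinj⟩ := hd (Finset.univ.val.map f) (by simpa using hf)
    (by rw [Multiset.map_map]; exact hsum)
  obtain ⟨w, rfl⟩ := Multiset.exists_eq_map_pair _ f Q hQ
  refine ⟨w, fun a ha => funext fun e => ?_⟩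
  have := hinj (fun e => if h : e ∈ triangle d then a ⟨e, h⟩ else 0) (fun P hP p q hpq => ?_) e e.2
  · simpa using this
  · obtain ⟨i, -, rfl⟩ := Multiset.mem_map.mp hP
    rw [← ha i p q hpq, ← Finset.sum_coe_sort]
    exact Finset.sum_congr rfl fun e _ => by simp

theorem pderiv_comm {σ R : Type*} [CommRing R] (i j : σ) (F : MvPolynomial σ R) :
    pderiv i (pderiv j F) = pderiv j (pderiv i F) := by
  classical
  have h : ⁅(pderiv i : Derivation R (MvPolynomial σ R) _),
      (pderiv j : Derivation R (MvPolynomial σ R) _)⁆ = 0 := by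
    refine MvPolynomial.derivation_ext fun l => ?_
    rw [Derivation.commutator_apply, pderiv_X, pderiv_X]
    simp only [Pi.single_apply]
    split_ifs <;> simp
  have := congrArg (fun D => D F) h
  rwa [Derivation.commutator_apply, Derivation.zero_apply, sub_eq_zero] at this

theorem diffOp_apply (k : Fin 3 → ℕ) (F : MvPolynomial (Fin 3) ℂ) :
    diffOp k F = (pderiv 0)^[k 0] ((pderiv 1)^[k 1] ((pderiv 2)^[k 2] F)) := by
  simp [diffOp, Module.End.mul_apply, Module.End.pow_apply]

theorem diffOp_pderiv (k : Fin 3 → ℕ) (j : Fin 3) (F : MvPolynomial (Fin 3) ℂ) :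
    diffOp k (pderiv j F) = diffOp (k + Pi.single j 1) F := by
  have hc : ∀ (i j : Fin 3) (n : ℕ) (G : MvPolynomial (Fin 3) ℂ),
      (pderiv i)^[n] (pderiv j G) = pderiv j ((pderiv i)^[n] G) := fun i j n G =>
    Function.Commute.iterate_left (fun G => pderiv_comm i j G) n G
  rw [diffOp_apply, diffOp_apply]
  fin_cases j <;> simp [Function.iterate_succ_apply, hc]

theorem diffOp_comm_pderiv (k : Fin 3 → ℕ) (j : Fin 3) (F : MvPolynomial (Fin 3) ℂ) :
    diffOp k (pderiv j F) = pderiv j (diffOp k F) := by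
  have hc : ∀ (i j : Fin 3) (n : ℕ) (G : MvPolynomial (Fin 3) ℂ),
      (pderiv i)^[n] (pderiv j G) = pderiv j ((pderiv i)^[n] G) := fun i j n G =>
    Function.Commute.iterate_left (fun G => pderiv_comm i j G) n G
  simp only [diffOp_apply, hc]

theorem mem_vanishingSubmodule {m : ℕ} {p : Fin 3 → ℂ} {F : MvPolynomial (Fin 3) ℂ} :
    F ∈ vanishingSubmodule m p ↔ ∀ k : Fin 3 → ℕ, k 0 + k 1 + k 2 < m →
      eval p (diffOp k F) = 0 := by
  simp [vanishingSubmodule, aeval_eq_eval]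

theorem isHomogeneous_diffOp {d : ℕ} {F : MvPolynomial (Fin 3) ℂ} (hF : F.IsHomogeneous d)
    (k : Fin 3 → ℕ) : (diffOp k F).IsHomogeneous (d - (k 0 + k 1 + k 2)) := by
  have h : ∀ (i : Fin 3) (n e : ℕ) (G : MvPolynomial (Fin 3) ℂ), G.IsHomogeneous e →
      ((pderiv i)^[n] G).IsHomogeneous (e - n) := by
    intro i n e G hG
    induction n with
    | zero => exact hG
    | succ n ih =>
      rw [Function.iterate_succ_apply']
      exact ih.pderiv
  rw [diffOp_apply]
  convert h 0 (k 0) _ _ (h 1 (k 1) _ _ (h 2 (k 2) _ _ hF)) using 1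
  omega

theorem mem_vanishingSubmodule_succ {m : ℕ} {p : Fin 3 → ℂ} {F : MvPolynomial (Fin 3) ℂ} :
    F ∈ vanishingSubmodule (m + 1) p ↔
      eval p F = 0 ∧ ∀ j, pderiv j F ∈ vanishingSubmodule m p := by
  simp only [mem_vanishingSubmodule, diffOp_pderiv]
  constructor
  · intro h
    refine ⟨by simpa [diffOp_apply] using h 0 (by simp), fun j k hk => h _ ?_⟩
    fin_cases j <;> simp <;> omega
  · rintro ⟨h0, h⟩ k hk
    have hk' : ∀ j, k j ≠ 0 → k - Pi.single j 1 + Pi.single j 1 = k := fun j hj => by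
      ext i
      by_cases hij : i = j
      · subst hij
        simp only [Pi.add_apply, Pi.sub_apply, Pi.single_eq_same]
        omega
      · simp [hij]
    by_cases hz : ∃ j, k j ≠ 0
    · obtain ⟨j, hj⟩ := hz
      rw [← hk' j hj]
      refine h j _ ?_
      have h3 := hk' j hj
      have h0 := congrFun h3 0
      have h1 := congrFun h3 1
      have h2 := congrFun h3 2
      fin_cases j <;> simp at h0 h1 h2 hj ⊢ <;> omega
    · push Not at hz
      obtain rfl : k = 0 := funext hz
      simpa [diffOp_apply] using h0

theorem vanishingSubmodule_anti {m m' : ℕ} (h : m ≤ m') (p : Fin 3 → ℂ) :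
    vanishingSubmodule m' p ≤ vanishingSubmodule m p := fun _ hF =>
  mem_vanishingSubmodule.mpr fun k hk => mem_vanishingSubmodule.mp hF k (hk.trans_le h)

theorem X_mul_mem_vanishingSubmodule {m : ℕ} {p : Fin 3 → ℂ} {F : MvPolynomial (Fin 3) ℂ}
    (hF : F ∈ vanishingSubmodule m p) (i : Fin 3) : X i * F ∈ vanishingSubmodule m p := by
  induction m generalizing F with
  | zero => exact mem_vanishingSubmodule.mpr fun k hk => absurd hk (Nat.not_lt_zero _)
  | succ m ih =>
    have h := mem_vanishingSubmodule_succ.mp hF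
    refine mem_vanishingSubmodule_succ.mpr ⟨by simp [h.1], fun j => ?_⟩
    rw [pderiv_mul, pderiv_X]
    refine add_mem ?_ (ih (h.2 j))
    by_cases hij : i = j
    · subst hij
      rw [Pi.single_eq_same, one_mul]
      exact vanishingSubmodule_anti (Nat.le_succ m) p hF
    · simp [hij]

theorem X_mul_pderiv_mem_vanishingSubmodule {m : ℕ} {p : Fin 3 → ℂ} {F : MvPolynomial (Fin 3) ℂ}
    (hF : F ∈ vanishingSubmodule (m + 1) p) (i : Fin 3) :
    X i * pderiv i F ∈ vanishingSubmodule m p :=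
  X_mul_mem_vanishingSubmodule ((mem_vanishingSubmodule_succ.mp hF).2 i) i

/-- By Euler's identity, only the derivatives of highest order matter for homogeneous
polynomials. -/
theorem mem_vanishingSubmodule_iff_of_isHomogeneous {m d : ℕ} {p : Fin 3 → ℂ}
    {F : MvPolynomial (Fin 3) ℂ} (hF : F.IsHomogeneous d) (hm : 1 ≤ m) (hmd : m ≤ d) :
    F ∈ vanishingSubmodule m p ↔ ∀ e : triangle (m - 1),
      eval p (diffOp ![e.1.1, e.1.2, m - 1 - (e.1.1 + e.1.2)] F) = 0 := by
  rw [mem_vanishingSubmodule]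
  constructor
  · intro h e
    have := mem_triangle.mp e.2
    exact h _ (by simp; omega)
  · intro h
    have key : ∀ n, n < m → ∀ k : Fin 3 → ℕ, k 0 + k 1 + k 2 + n = m - 1 →
        eval p (diffOp k F) = 0 := by
      intro n
      induction n with
      | zero =>
        intro _ k hk
        have hk' : ![k 0, k 1, m - 1 - (k 0 + k 1)] = k := by
          ext i
          fin_cases i <;> simp
          omega
        have h1 := h ⟨(k 0, k 1), mem_triangle.mpr (by dsimp only; omega)⟩
        rwa [hk'] at h1
      | succ n ih =>
        intro hn k hk
        have h1 := congrArg (eval p) (isHomogeneous_diffOp hF k).sum_X_mul_pderiv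
        have h2 : ∀ j, eval p (X j * pderiv j (diffOp k F)) = 0 := fun j => by
          rw [map_mul, ← diffOp_comm_pderiv, diffOp_pderiv, ih (by omega), mul_zero]
          fin_cases j <;> simp <;> omega
        rw [map_sum, Finset.sum_congr rfl fun j _ => h2 j, Finset.sum_const_zero, map_nsmul] at h1
        exact (smul_eq_zero.mp h1.symm).resolve_left (by omega)
    exact fun k hk => key (m - 1 - (k 0 + k 1 + k 2)) (by omega) k (by omega)

theorem MvPolynomial.IsHomogeneous.eval_smul {σ R : Type*} [CommSemiring R] {n : ℕ}
    {F : MvPolynomial σ R} (hF : F.IsHomogeneous n) (c : R) (p : σ → R) :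
    eval (c • p) F = c ^ n * eval p F := by
  rw [eval_eq, eval_eq, Finset.mul_sum]
  refine Finset.sum_congr rfl fun s hs => ?_
  have hs' : ∑ i ∈ s.support, s i = n := by
    rw [← hF (mem_support_iff.mp hs), Finsupp.weight_apply, Finsupp.sum]
    simp
  simp only [Pi.smul_apply, smul_eq_mul, mul_pow, Finset.prod_mul_distrib,
    Finset.prod_pow_eq_pow_sum, hs']
  ring

theorem mem_vanishingSubmodule_smul {m d : ℕ} {p : Fin 3 → ℂ} {F : MvPolynomial (Fin 3) ℂ}
    (hF : F.IsHomogeneous d) {c : ℂ} (hc : c ≠ 0) :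
    F ∈ vanishingSubmodule m (c • p) ↔ F ∈ vanishingSubmodule m p := by
  simp only [mem_vanishingSubmodule, (isHomogeneous_diffOp hF _).eval_smul, mul_eq_zero,
    pow_eq_zero_iff', hc, false_and, ne_eq, false_or]

/-- The exponent of the monomial `X ^ e.1 * Y ^ e.2 * Z ^ (d - e.1 - e.2)`. -/
def homogeneousExponent (d : ℕ) (e : ℕ × ℕ) : Fin 3 →₀ ℕ :=
  Finsupp.equivFunOnFinite.symm ![e.1, e.2, d - (e.1 + e.2)]

theorem homogeneousExponent_injective (d : ℕ) : Function.Injective (homogeneousExponent d) := by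
  intro e e' h
  have h0 := DFunLike.congr_fun h 0
  have h1 := DFunLike.congr_fun h 1
  exact Prod.ext (by simpa [homogeneousExponent] using h0) (by simpa [homogeneousExponent] using h1)

/-- The form of degree `d` with given coefficients. -/
def triangleForm (d : ℕ) : (triangle d → ℂ) →ₗ[ℂ] MvPolynomial (Fin 3) ℂ :=
  ∑ e : triangle d, monomial (homogeneousExponent d e) ∘ₗ LinearMap.proj e

theorem triangleForm_apply {d : ℕ} (a : triangle d → ℂ) :
    triangleForm d a = ∑ e : triangle d, monomial (homogeneousExponent d e) (a e) := by
  simp [triangleForm]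

theorem coeff_triangleForm {d : ℕ} (a : triangle d → ℂ) (e : triangle d) :
    coeff (homogeneousExponent d e) (triangleForm d a) = a e := by
  rw [triangleForm_apply, coeff_sum, Finset.sum_eq_single e, coeff_monomial, if_pos rfl]
  · intro e' _ he'
    rw [coeff_monomial, if_neg]
    exact fun h => he' (Subtype.ext (homogeneousExponent_injective d h))
  · exact fun h => absurd (Finset.mem_univ e) h

theorem triangleForm_injective (d : ℕ) : Function.Injective (triangleForm d) := fun a b h =>
  funext fun e => by rw [← coeff_triangleForm a, h, coeff_triangleForm]

theorem isHomogeneous_triangleForm {d : ℕ} (a : triangle d → ℂ) :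
    (triangleForm d a).IsHomogeneous d := by
  rw [triangleForm_apply]
  refine IsHomogeneous.sum _ _ _ fun e _ => isHomogeneous_monomial _ ?_
  have := mem_triangle.mp e.2
  rw [Finsupp.degree_eq_sum, Fin.sum_univ_three]
  simp [homogeneousExponent]
  omega

theorem range_triangleForm (d : ℕ) :
    LinearMap.range (triangleForm d) = homogeneousSubmodule (Fin 3) ℂ d := by
  refine le_antisymm ?_ fun F hF => ?_
  · rintro _ ⟨a, rfl⟩
    exact isHomogeneous_triangleForm a
  · refine ⟨fun e => coeff (homogeneousExponent d e) F, ?_⟩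
    ext s
    by_cases hs : s.degree = d
    · rw [Finsupp.degree_eq_sum, Fin.sum_univ_three] at hs
      have hse : s = homogeneousExponent d (s 0, s 1) := by
        ext i
        fin_cases i <;> simp [homogeneousExponent]
        omega
      have he : (s 0, s 1) ∈ triangle d := mem_triangle.mpr (by dsimp only; omega)
      rw [hse]
      exact coeff_triangleForm _ ⟨_, he⟩
    · rw [(isHomogeneous_triangleForm _).coeff_eq_zero hs,
        ((mem_homogeneousSubmodule _ _).mp hF).coeff_eq_zero hs]

theorem X_mul_pderiv_triangleForm {d : ℕ} (a : triangle d → ℂ) (i : Fin 3) :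
    X i * pderiv i (triangleForm d a) =
      triangleForm d fun e => a e * (homogeneousExponent d e i : ℂ) := by
  rw [triangleForm_apply, triangleForm_apply, map_sum, Finset.mul_sum]
  refine Finset.sum_congr rfl fun e _ => ?_
  rw [X_mul_pderiv_monomial, ← map_nsmul, nsmul_eq_mul, mul_comm]

theorem eval_triangleForm {d : ℕ} (a : triangle d → ℂ) (x y : ℂ) :
    eval ![x, y, 1] (triangleForm d a) = ∑ e : triangle d, a e * (x ^ e.1.1 * y ^ e.1.2) := by
  rw [triangleForm_apply, map_sum]
  refine Finset.sum_congr rfl fun e _ => ?_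
  rw [eval_monomial, Finsupp.prod_fintype _ _ (by simp), Fin.prod_univ_three]
  simp [homogeneousExponent]

theorem sum_eq_zero_of_triangleForm_mem {d m : ℕ} {a : triangle d → ℂ} {x y : ℂ}
    (h : triangleForm d a ∈ vanishingSubmodule m ![x, y, 1]) (p q : ℕ) (hpq : p + q < m) :
    ∑ e : triangle d, a e * ((e.1.1 : ℂ) ^ p * (e.1.2 : ℂ) ^ q * (x ^ e.1.1 * y ^ e.1.2)) = 0 := by
  induction p generalizing m a with
  | zero =>
    induction q generalizing m a with
    | zero =>
      obtain ⟨m, rfl⟩ : ∃ m', m = m' + 1 := ⟨m - 1, by omega⟩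
      have := (mem_vanishingSubmodule_succ.mp h).1
      rw [eval_triangleForm] at this
      simpa using this
    | succ q ih =>
      obtain ⟨m, rfl⟩ : ∃ m', m = m' + 1 := ⟨m - 1, by omega⟩
      have h1 := X_mul_pderiv_mem_vanishingSubmodule h 1
      rw [X_mul_pderiv_triangleForm] at h1
      rw [← ih h1 (by omega)]
      refine Finset.sum_congr rfl fun e _ => ?_
      simp only [homogeneousExponent, Finsupp.equivFunOnFinite_symm_apply_apply, Matrix.cons_val]
      ring
  | succ p ih =>
    obtain ⟨m, rfl⟩ : ∃ m', m = m' + 1 := ⟨m - 1, by omega⟩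
    have h1 := X_mul_pderiv_mem_vanishingSubmodule h 0
    rw [X_mul_pderiv_triangleForm] at h1
    rw [← ih h1 (by omega)]
    refine Finset.sum_congr rfl fun e _ => ?_
    simp only [homogeneousExponent, Finsupp.equivFunOnFinite_symm_apply_apply, Matrix.cons_val]
    ring

/-- The matrix of the conditions imposed on forms of degree `d` by points of multiplicities `f i`,
as polynomials in the coordinates of the points. -/
def conditionMatrix (d : ℕ) {ι : Type*} (f : ι → ℕ) :
    Matrix (Σ i, triangle (f i - 1)) (triangle d) (MvPolynomial (ι × Fin 3) ℂ) := fun c e =>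
  rename (Prod.mk c.1) (diffOp ![c.2.1.1, c.2.1.2, f c.1 - 1 - (c.2.1.1 + c.2.1.2)]
    (monomial (homogeneousExponent d e) 1))

/-- The values of the entries of the condition matrix at given points. -/
def conditionMatrixAt (d : ℕ) {ι : Type*} (f : ι → ℕ) (v : ι → Fin 3 → ℂ) :
    Matrix (Σ i, triangle (f i - 1)) (triangle d) ℂ :=
  (conditionMatrix d f).map (eval fun c => v c.1 c.2)

theorem conditionMatrixAt_mulVec {d : ℕ} {ι : Type*} (f : ι → ℕ) (v : ι → Fin 3 → ℂ)
    (a : triangle d → ℂ) (c : Σ i, triangle (f i - 1)) :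
    (conditionMatrixAt d f v).mulVec a c =
      eval (v c.1) (diffOp ![c.2.1.1, c.2.1.2, f c.1 - 1 - (c.2.1.1 + c.2.1.2)]
        (triangleForm d a)) := by
  rw [triangleForm_apply, map_sum, map_sum]
  refine Finset.sum_congr rfl fun e _ => ?_
  have h : monomial (homogeneousExponent d e) (a e) =
      a e • monomial (homogeneousExponent d e.1) (1 : ℂ) := by
    rw [smul_monomial, smul_eq_mul, mul_one]
  rw [h, map_smul, smul_eval, mul_comm]
  exact congrArg (a e * ·) (eval_rename _ _ _)

theorem conditionMatrixAt_mulVec_eq_zero {d : ℕ} {ι : Type*} {f : ι → ℕ} (hf : ∀ i, 1 ≤ f i)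
    (hfd : ∀ i, f i ≤ d) (v : ι → Fin 3 → ℂ) (a : triangle d → ℂ) :
    (conditionMatrixAt d f v).mulVec a = 0 ↔
      ∀ i, triangleForm d a ∈ vanishingSubmodule (f i) (v i) := by
  simp only [mem_vanishingSubmodule_iff_of_isHomogeneous (isHomogeneous_triangleForm a) (hf _)
    (hfd _), funext_iff, conditionMatrixAt_mulVec, Sigma.forall, Pi.zero_apply]

theorem Lspace_eq_map {d r : ℕ} {f : Fin r → ℕ} (hf : ∀ i, 1 ≤ f i) (hfd : ∀ i, f i ≤ d)
    {P : Fin r → Proj2} {v : Fin r → Fin 3 → ℂ} (hv : ∀ i, v i ≠ 0)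
    (hP : ∀ i, Projectivization.mk ℂ (v i) (hv i) = P i) :
    Lspace d P f =
      (LinearMap.ker (conditionMatrixAt d f v).mulVecLin).map (triangleForm d) := by
  have hrep : ∀ i, ∃ c : ℂ, c ≠ 0 ∧ v i = c • (P i).rep := fun i => by
    have h := hP i
    rw [← (P i).mk_rep, Projectivization.mk_eq_mk_iff] at h
    obtain ⟨c, hc⟩ := h
    exact ⟨c, c.ne_zero, hc.symm⟩
  have hmem : ∀ a, a ∈ LinearMap.ker (conditionMatrixAt d f v).mulVecLin ↔
      triangleForm d a ∈ ⨅ i, vanishingSubmodule (f i) (P i).rep := fun a => by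
    rw [LinearMap.mem_ker, Matrix.mulVecLin_apply, conditionMatrixAt_mulVec_eq_zero hf hfd,
      Submodule.mem_iInf]
    refine forall_congr' fun i => ?_
    obtain ⟨c, hc, hci⟩ := hrep i
    rw [hci, mem_vanishingSubmodule_smul (isHomogeneous_triangleForm a) hc]
  rw [Lspace, ← range_triangleForm]
  ext F
  constructor
  · rintro ⟨⟨a, rfl⟩, ha⟩
    exact ⟨a, (hmem a).mpr ha, rfl⟩
  · rintro ⟨a, ha, rfl⟩
    exact ⟨⟨a, rfl⟩, (hmem a).mp ha⟩

theorem finrank_Lspace {d r : ℕ} {f : Fin r → ℕ} (hf : ∀ i, 1 ≤ f i) (hfd : ∀ i, f i ≤ d)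
    {P : Fin r → Proj2} {v : Fin r → Fin 3 → ℂ} (hv : ∀ i, v i ≠ 0)
    (hP : ∀ i, Projectivization.mk ℂ (v i) (hv i) = P i) :
    Module.finrank ℂ (Lspace d P f) =
      Module.finrank ℂ (LinearMap.ker (conditionMatrixAt d f v).mulVecLin) := by
  rw [Lspace_eq_map hf hfd hv hP]
  exact (Submodule.equivMapOfInjective _ (triangleForm_injective d) _).finrank_eq.symm

theorem card_sigma_triangle {ι : Type*} [Fintype ι] {f : ι → ℕ} (hf : ∀ i, 1 ≤ f i) :
    Fintype.card (Σ i, triangle (f i - 1)) = ∑ i, tri (f i) := by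
  rw [Fintype.card_sigma]
  refine Finset.sum_congr rfl fun i _ => ?_
  rw [Fintype.card_coe, card_triangle, Nat.sub_add_cancel (hf i)]

theorem exists_injective_conditionMatrixAt {m d : ℕ} {ι : Type*} [Fintype ι] {f : ι → ℕ}
    (hd : ∀ ms : Multiset ℕ, (∀ k ∈ ms, 1 ≤ k ∧ k ≤ m) → tri (d + 1) ≤ (ms.map tri).sum →
      NonSpecial (triangle d) ms)
    (hmd : m ≤ d) (hf : ∀ i, 1 ≤ f i ∧ f i ≤ m) (hsum : tri (d + 1) ≤ ∑ i, tri (f i)) :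
    ∃ v : ι → Fin 3 → ℂ, Function.Injective (conditionMatrixAt d f v).mulVec := by
  obtain ⟨w, hw⟩ := exists_torus_points hd hf hsum
  refine ⟨fun i => ![(w i).1, (w i).2, 1], ?_⟩
  refine (injective_iff_map_eq_zero (conditionMatrixAt d f _).mulVecLin).mpr fun a ha => hw a ?_
  exact fun i p q => sum_eq_zero_of_triangleForm_mem ((conditionMatrixAt_mulVec_eq_zero
    (fun i => (hf i).1) (fun i => (hf i).2.trans hmd) _ a).mp ha i) p q

theorem exists_surjective_conditionMatrixAt {m d : ℕ} {ι : Type*} [Fintype ι] {f : ι → ℕ}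
    (hd : ∀ ms : Multiset ℕ, (∀ k ∈ ms, 1 ≤ k ∧ k ≤ m) → tri (d + 1) ≤ (ms.map tri).sum →
      NonSpecial (triangle d) ms)
    (hm : 1 ≤ m) (hmd : m ≤ d) (hf : ∀ i, 1 ≤ f i ∧ f i ≤ m)
    (hsum : ∑ i, tri (f i) ≤ tri (d + 1)) :
    ∃ v : ι → Fin 3 → ℂ, Function.Surjective (conditionMatrixAt d f v).mulVec := by
  obtain ⟨N, hN⟩ := Nat.exists_eq_add_of_le hsum
  let f' : ι ⊕ Fin N → ℕ := Sum.elim f fun _ => 1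
  have hf' : ∀ i, 1 ≤ f' i ∧ f' i ≤ m := by
    rintro (i | i)
    · exact hf i
    · exact ⟨le_rfl, hm⟩
  have hsum' : tri (d + 1) = ∑ i, tri (f' i) := by
    rw [hN, Fintype.sum_sum_type]
    simp [f', tri]
  obtain ⟨v, hv⟩ := exists_injective_conditionMatrixAt hd hmd hf' hsum'.le
  have hsurj : Function.Surjective (conditionMatrixAt d f' v).mulVecLin := by
    refine (LinearMap.injective_iff_surjective_of_finrank_eq_finrank ?_).mp hv
    rw [Module.finrank_fintype_fun_eq_card, Module.finrank_fintype_fun_eq_card, Fintype.card_coe,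
      card_triangle, card_sigma_triangle fun i => (hf' i).1, hsum']
  refine ⟨fun i => v (Sum.inl i), fun b => ?_⟩
  obtain ⟨a, ha⟩ := hsurj fun c => match c with
    | ⟨Sum.inl i, e⟩ => b ⟨i, e⟩
    | ⟨Sum.inr _, _⟩ => 0
  refine ⟨a, funext fun c => ?_⟩
  have := congrFun ha ⟨Sum.inl c.1, c.2⟩
  rw [Matrix.mulVecLin_apply, conditionMatrixAt_mulVec] at this
  rw [conditionMatrixAt_mulVec]
  exact this

/-- Injectivity of a matrix of polynomials is a nonempty principal open condition. -/
theorem exists_forall_injective_mulVec {σ m n : Type*} [Fintype m] [Fintype n]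
    (M : Matrix m n (MvPolynomial σ ℂ)) {x₀ : σ → ℂ}
    (h : Function.Injective (M.map (eval x₀)).mulVec) :
    ∃ g : MvPolynomial σ ℂ, g ≠ 0 ∧
      ∀ x, eval x g ≠ 0 → Function.Injective (M.map (eval x)).mulVec := by
  classical
  obtain ⟨S, hS⟩ : ∃ S : Matrix n m ℂ, S * M.map (eval x₀) = 1 := by
    obtain ⟨g, hg⟩ := (M.map (eval x₀)).mulVecLin.exists_leftInverse_of_injective
      (LinearMap.ker_eq_bot.mpr h)
    refine ⟨LinearMap.toMatrix' g, ?_⟩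
    rw [← LinearMap.toMatrix'_toLin' (M.map (eval x₀)), ← LinearMap.toMatrix'_comp,
      Matrix.toLin'_apply', hg, LinearMap.toMatrix'_id]
  let S' : Matrix n m (MvPolynomial σ ℂ) := S.map C
  have key : ∀ x, eval x (S' * M).det = (S * M.map (eval x)).det := fun x => by
    rw [RingHom.map_det, RingHom.mapMatrix_apply, Matrix.map_mul]
    congr 2
    ext
    simp [S']
  refine ⟨(S' * M).det, fun h0 => ?_, fun x hx => ?_⟩
  · have := key x₀
    rw [h0, hS, map_zero, Matrix.det_one] at this
    exact zero_ne_one this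
  · rw [key] at hx
    have hinj := Matrix.mulVec_injective_of_isUnit
      ((Matrix.isUnit_iff_isUnit_det _).mpr (isUnit_iff_ne_zero.mpr hx))
    intro a b hab
    apply hinj
    rw [← Matrix.mulVec_mulVec, hab, Matrix.mulVec_mulVec]

/-- Surjectivity of a matrix of polynomials is a nonempty principal open condition. -/
theorem exists_forall_surjective_mulVec {σ m n : Type*} [Fintype m] [Fintype n]
    (M : Matrix m n (MvPolynomial σ ℂ)) {x₀ : σ → ℂ}
    (h : Function.Surjective (M.map (eval x₀)).mulVec) :
    ∃ g : MvPolynomial σ ℂ, g ≠ 0 ∧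
      ∀ x, eval x g ≠ 0 → Function.Surjective (M.map (eval x)).mulVec := by
  classical
  obtain ⟨R, hR⟩ := Matrix.mulVec_surjective_iff_exists_right_inverse.mp h
  let R' : Matrix n m (MvPolynomial σ ℂ) := R.map C
  have key : ∀ x, eval x (M * R').det = (M.map (eval x) * R).det := fun x => by
    rw [RingHom.map_det, RingHom.mapMatrix_apply, Matrix.map_mul]
    congr 2
    ext
    simp [R']
  refine ⟨(M * R').det, fun h0 => ?_, fun x hx => ?_⟩
  · have := key x₀
    rw [h0, hR, map_zero, Matrix.det_one] at this
    exact zero_ne_one this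
  · rw [key] at hx
    have hU := isUnit_iff_ne_zero.mpr hx
    intro b
    refine ⟨R.mulVec ((M.map (eval x) * R)⁻¹.mulVec b), ?_⟩
    rw [Matrix.mulVec_mulVec, Matrix.mulVec_mulVec, Matrix.mul_nonsing_inv _ hU, Matrix.one_mulVec]

theorem finrank_ker_mulVecLin_of_surjective {m n : Type*} [Fintype m] [Fintype n]
    {M : Matrix m n ℂ} (h : Function.Surjective M.mulVec) :
    Module.finrank ℂ (LinearMap.ker M.mulVecLin) = Fintype.card n - Fintype.card m := by
  have h1 := M.mulVecLin.finrank_range_add_finrank_ker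
  rw [LinearMap.range_eq_top.mpr h, finrank_top, Module.finrank_fintype_fun_eq_card,
    Module.finrank_fintype_fun_eq_card] at h1
  omega

/-- In large degree, the conditions imposed by points outside a hypersurface are as independent
as possible. -/
theorem exists_forall_finrank_ker_conditionMatrixAt {m d : ℕ} {ι : Type*} [Fintype ι] {f : ι → ℕ}
    (hd : ∀ ms : Multiset ℕ, (∀ k ∈ ms, 1 ≤ k ∧ k ≤ m) → tri (d + 1) ≤ (ms.map tri).sum →
      NonSpecial (triangle d) ms)
    (hm : 1 ≤ m) (hmd : m ≤ d) (hf : ∀ i, 1 ≤ f i ∧ f i ≤ m) :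
    ∃ g : MvPolynomial (ι × Fin 3) ℂ, g ≠ 0 ∧ ∀ v : ι → Fin 3 → ℂ,
      eval (fun c => v c.1 c.2) g ≠ 0 →
      Module.finrank ℂ (LinearMap.ker (conditionMatrixAt d f v).mulVecLin) =
        tri (d + 1) - ∑ i, tri (f i) := by
  rcases le_total (tri (d + 1)) (∑ i, tri (f i)) with hsum | hsum
  · obtain ⟨v₀, hv₀⟩ := exists_injective_conditionMatrixAt hd hmd hf hsum
    obtain ⟨g, hg, h⟩ := exists_forall_injective_mulVec (conditionMatrix d f) hv₀
    refine ⟨g, hg, fun v hv => ?_⟩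
    have hker : LinearMap.ker (conditionMatrixAt d f v).mulVecLin = ⊥ :=
      LinearMap.ker_eq_bot.mpr (h _ hv)
    rw [hker, finrank_bot, Nat.sub_eq_zero_of_le hsum]
  · obtain ⟨v₀, hv₀⟩ := exists_surjective_conditionMatrixAt hd hm hmd hf hsum
    obtain ⟨g, hg, h⟩ := exists_forall_surjective_mulVec (conditionMatrix d f) hv₀
    refine ⟨g, hg, fun v hv => ?_⟩
    have hv : Function.Surjective (conditionMatrixAt d f v).mulVec := h _ hv
    rw [finrank_ker_mulVecLin_of_surjective hv, Fintype.card_coe, card_triangle,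
      card_sigma_triangle fun i => (hf i).1]

theorem isOpen_vectorZariski_setOf_eval_ne_zero {V σ : Type*} [AddCommGroup V] [Module ℂ V]
    [Finite σ] (f : MvPolynomial σ ℂ) (φ : σ → V →ₗ[ℂ] ℂ) :
    @IsOpen _ (vectorZariski V) {v | eval (fun i => φ i v) f ≠ 0} := by
  have := Fintype.ofFinite σ
  let e := Fintype.equivFin σ
  refine TopologicalSpace.isOpen_generateFrom_of_mem ⟨_, rename e f, fun i => φ (e.symm i), ?_⟩
  ext v
  simp [eval_rename, Function.comp_def]

/-- Polynomials restrict to univariate polynomials on affine lines. -/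
theorem exists_eval_add_smul {V σ : Type*} [AddCommGroup V] [Module ℂ V] (f : MvPolynomial σ ℂ)
    (φ : σ → V →ₗ[ℂ] ℂ) (x y : V) :
    ∃ p : Polynomial ℂ, ∀ s : ℂ, eval (fun i => φ i (x + s • y)) f = p.eval s := by
  refine ⟨aeval (fun i => Polynomial.C (φ i x) + Polynomial.C (φ i y) * Polynomial.X) f,
    fun s => ?_⟩
  induction f using MvPolynomial.induction_on with
  | C a => simp
  | add p q hp hq => rw [map_add, map_add, Polynomial.eval_add, hp, hq]
  | mul_X p i hp => rw [map_mul, map_mul, Polynomial.eval_mul, hp]; simp [mul_comm s]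

/-- Every point of a Zariski open set has a principal open neighbourhood in it, whose equation is
polynomial on lines. -/
theorem exists_principal_subset {V : Type*} [AddCommGroup V] [Module ℂ V] {O : Set V}
    (hO : @IsOpen _ (vectorZariski V) O) {x : V} (hx : x ∈ O) :
    ∃ h : V → ℂ, (∀ x y, ∃ p : Polynomial ℂ, ∀ s : ℂ, h (x + s • y) = p.eval s) ∧ h x ≠ 0 ∧
      ∀ y, h y ≠ 0 → y ∈ O := by
  induction hO with
  | basic U hU =>
    obtain ⟨n, f, φ, rfl⟩ := hU
    exact ⟨fun v => eval (fun i => φ i v) f, exists_eval_add_smul f φ, hx, fun _ h => h⟩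
  | univ => exact ⟨fun _ => 1, fun _ _ => ⟨1, by simp⟩, one_ne_zero, fun _ _ => trivial⟩
  | inter U W _ _ hU hW =>
    obtain ⟨h, hp, h1, h2⟩ := hU hx.1
    obtain ⟨k, kp, k1, k2⟩ := hW hx.2
    refine ⟨fun v => h v * k v, fun x y => ?_, mul_ne_zero h1 k1, fun y hy =>
      ⟨h2 y (left_ne_zero_of_mul hy), k2 y (right_ne_zero_of_mul hy)⟩⟩
    obtain ⟨p, hp⟩ := hp x y
    obtain ⟨q, hq⟩ := kp x y
    exact ⟨p * q, fun s => by rw [Polynomial.eval_mul, ← hp, ← hq]⟩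
  | sUnion S _ ih =>
    obtain ⟨U, hU, hxU⟩ := hx
    obtain ⟨h, hp, h1, h2⟩ := ih U hU hxU
    exact ⟨h, hp, h1, fun y hy => ⟨U, hU, h2 y hy⟩⟩

theorem exists_mem_eval_ne_zero {ι κ : Type*} {O : Set (ι → κ → ℂ)}
    (hO : @IsOpen _ (vectorZariski (ι → κ → ℂ)) O) (hne : O.Nonempty)
    {G : MvPolynomial (ι × κ) ℂ} (hG : G ≠ 0) :
    ∃ v ∈ O, eval (fun c => v c.1 c.2) G ≠ 0 := by
  obtain ⟨x, hx⟩ := hne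
  obtain ⟨h, hp, hx0, hO⟩ := exists_principal_subset hO hx
  obtain ⟨y, hy⟩ : ∃ y, eval y G ≠ 0 := by
    by_contra! H
    exact hG (MvPolynomial.funext fun y => by rw [H, map_zero])
  let z : ι → κ → ℂ := fun i k => y (i, k)
  obtain ⟨p, hp⟩ := hp x (z - x)
  obtain ⟨q, hq⟩ := exists_eval_add_smul G
    (fun c => LinearMap.proj c.2 ∘ₗ (LinearMap.proj c.1 : (ι → κ → ℂ) →ₗ[ℂ] κ → ℂ)) x (z - x)
  have hp0 : p ≠ 0 := by
    rintro rfl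
    apply hx0
    simpa using hp 0
  have hq0 : q ≠ 0 := by
    rintro rfl
    apply hy
    simpa [z] using hq 1
  obtain ⟨s, hs⟩ : ∃ s, (p * q).eval s ≠ 0 := by
    by_contra! H
    exact mul_ne_zero hp0 hq0 (Polynomial.funext fun s => by rw [H, Polynomial.eval_zero])
  rw [Polynomial.eval_mul, ← hp, ← hq] at hs
  exact ⟨_, hO _ (left_ne_zero_of_mul hs), right_ne_zero_of_mul hs⟩

/-- The set of tuples of points with some representative outside the hypersurface `G = 0`. -/
def tupleLocus {r : ℕ} (G : MvPolynomial (Fin r × Fin 3) ℂ) : Set (Fin r → Proj2) :=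
  {P | ∃ (v : Fin r → Fin 3 → ℂ) (hv : ∀ i, v i ≠ 0),
    (∀ i, Projectivization.mk ℂ (v i) (hv i) = P i) ∧ eval (fun c => v c.1 c.2) G ≠ 0}

theorem isOpen_tupleLocus {r : ℕ} (G : MvPolynomial (Fin r × Fin 3) ℂ) :
    @IsOpen _ (projTupleZariski r) (tupleLocus G) := by
  refine isOpen_coinduced.mpr ((@isOpen_induced_iff _ _ (vectorZariski _) _ _).mpr
    ⟨⋃ c : Fin r → ℂˣ, {v | eval (fun p => (c p.1 : ℂ) * v p.1 p.2) G ≠ 0}, ?_, ?_⟩)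
  · refine @isOpen_iUnion _ _ (vectorZariski _) _ fun c => ?_
    exact isOpen_vectorZariski_setOf_eval_ne_zero G fun p => (c p.1 : ℂ) •
      (LinearMap.proj p.2 ∘ₗ (LinearMap.proj p.1 : (Fin r → Fin 3 → ℂ) →ₗ[ℂ] Fin 3 → ℂ))
  · ext ⟨v, hv⟩
    simp only [Set.mem_preimage, Set.mem_iUnion, Set.mem_ofPred_eq, tupleLocus]
    constructor
    · rintro ⟨c, hc⟩
      refine ⟨fun i => (c i : ℂ) • v i, fun i => smul_ne_zero (c i).ne_zero (hv i), fun i => ?_, hc⟩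
      exact (Projectivization.mk_eq_mk_iff _ _ _ _ _).mpr ⟨c i, rfl⟩
    · rintro ⟨w, hw, hP, hG⟩
      choose c hc using fun i => (Projectivization.mk_eq_mk_iff _ _ _ _ _).mp (hP i)
      refine ⟨c, ?_⟩
      convert hG using 4 with p
      exact congrFun (hc p.1) p.2

theorem dense_tupleLocus {r : ℕ} {G : MvPolynomial (Fin r × Fin 3) ℂ} (hG : G ≠ 0)
    (hG0 : ∀ v : Fin r → Fin 3 → ℂ, eval (fun c => v c.1 c.2) G ≠ 0 → ∀ i, v i ≠ 0) :
    @Dense _ (projTupleZariski r) (tupleLocus G) := by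
  let _ := projTupleZariski r
  refine dense_iff_inter_open.mpr fun O hO hne => ?_
  obtain ⟨W, hW, hWO⟩ := (@isOpen_induced_iff _ _ (vectorZariski _) _ _).mp (isOpen_coinduced.mp hO)
  have hmem : ∀ v (hv : ∀ i, v i ≠ 0), (fun i => Projectivization.mk ℂ (v i) (hv i)) ∈ O ↔
      v ∈ W := fun v hv => (Set.ext_iff.mp hWO ⟨v, hv⟩).symm
  obtain ⟨P, hP⟩ := hne
  have hPW : (fun i => (P i).rep) ∈ W :=
    (hmem _ fun i => (P i).rep_nonzero).mp (by simpa only [Projectivization.mk_rep] using hP)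
  obtain ⟨v, hvW, hv⟩ := exists_mem_eval_ne_zero hW ⟨_, hPW⟩ hG
  exact ⟨_, (hmem v (hG0 v hv)).mpr hvW, v, hG0 v hv, fun _ => rfl, hv⟩

/-- A polynomial whose nonvanishing forces a tuple of vectors to represent distinct points. -/
def separatingPoly (r : ℕ) : MvPolynomial (Fin r × Fin 3) ℂ :=
  (∏ i, X (i, 2)) * ∏ p : Fin r × Fin r with p.1 ≠ p.2,
    (X (p.1, 0) * X (p.2, 2) - X (p.2, 0) * X (p.1, 2))

theorem separatingPoly_ne_zero (r : ℕ) : separatingPoly r ≠ 0 := by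
  refine mul_ne_zero (Finset.prod_ne_zero_iff.mpr fun i _ => X_ne_zero _)
    (Finset.prod_ne_zero_iff.mpr fun p hp h => ?_)
  have hp := (Finset.mem_filter.mp hp).2
  have := congrArg (eval fun c => if c = (p.1, 0) ∨ c = (p.2, 2) then 1 else 0) h
  simp [hp, hp.symm] at this

theorem ne_zero_of_eval_separatingPoly {r : ℕ} {v : Fin r → Fin 3 → ℂ}
    (h : eval (fun c => v c.1 c.2) (separatingPoly r) ≠ 0) (i : Fin r) : v i ≠ 0 := by
  rw [separatingPoly, map_mul, map_prod] at h
  have := Finset.prod_ne_zero_iff.mp (left_ne_zero_of_mul h) i (Finset.mem_univ i)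
  rw [eval_X] at this
  exact fun h0 => this (congrFun h0 2)

theorem mk_injective_of_eval_separatingPoly {r : ℕ} {v : Fin r → Fin 3 → ℂ}
    (h : eval (fun c => v c.1 c.2) (separatingPoly r) ≠ 0) (hv : ∀ i, v i ≠ 0) :
    Function.Injective fun i => Projectivization.mk ℂ (v i) (hv i) := by
  intro i j hij
  by_contra hne
  obtain ⟨c, hc⟩ := (Projectivization.mk_eq_mk_iff _ _ _ _ _).mp hij
  rw [separatingPoly, map_mul, map_prod, map_prod] at h
  refine Finset.prod_ne_zero_iff.mp (right_ne_zero_of_mul h) (i, j) (by simpa using hne) ?_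
  simp only [map_sub, map_mul, eval_X, ← hc, Pi.smul_apply, Units.smul_def, smul_eq_mul]
  ring

theorem natCast_mul_add_one_div_two (n : ℕ) : (n : ℤ) * ((n : ℤ) + 1) / 2 = tri n := by
  rw [tri]
  norm_cast

/-- For every positive integer `m` there is a degree bound `D` such that for
all `d ≥ D`, `r ≥ 1` and multiplicities `1 ≤ mᵢ ≤ m`, there is a dense Zariski-open set of
`r`-tuples of (pairwise distinct) points of `ℙ²(ℂ)` at which the space of degree-`d` forms
vanishing to order at least `mᵢ` at `Pᵢ` has the expected dimension
`max (0, (d+1)(d+2)/2 − Σ mᵢ(mᵢ+1)/2)`. -/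
theorem linear_system_expected_dimension :
    ∀ m : ℕ, 1 ≤ m → ∃ D : ℕ, ∀ d : ℕ, D ≤ d → ∀ r : ℕ, 1 ≤ r →
      ∀ mi : Fin r → ℕ, (∀ i, 1 ≤ mi i ∧ mi i ≤ m) →
        ∃ U : Set (Fin r → Proj2),
          @IsOpen _ (projTupleZariski r) U ∧ @Dense _ (projTupleZariski r) U ∧
          ∀ P ∈ U, Function.Injective P ∧
            (Module.finrank ℂ (Lspace d P mi) : ℤ) =
              max 0 (((d : ℤ) + 1) * ((d : ℤ) + 2) / 2
                - ∑ i, (mi i : ℤ) * ((mi i : ℤ) + 1) / 2) := by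
  intro m hm
  obtain ⟨D, hD⟩ := exists_nonSpecial_triangle m hm
  refine ⟨max D m, fun d hd r _ mi hmi => ?_⟩
  have hmd := (le_max_right D m).trans hd
  obtain ⟨g, hg, hfin⟩ := exists_forall_finrank_ker_conditionMatrixAt
    (hD d ((le_max_left D m).trans hd)) hm hmd hmi
  have hsep : ∀ v : Fin r → Fin 3 → ℂ, eval (fun c => v c.1 c.2) (g * separatingPoly r) ≠ 0 →
      eval (fun c => v c.1 c.2) (separatingPoly r) ≠ 0 := fun v hv =>
    right_ne_zero_of_mul (by rwa [map_mul] at hv)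
  refine ⟨tupleLocus (g * separatingPoly r), isOpen_tupleLocus _,
    dense_tupleLocus (mul_ne_zero hg (separatingPoly_ne_zero r)) fun v hv =>
      ne_zero_of_eval_separatingPoly (hsep v hv), ?_⟩
  rintro P ⟨v, hv, hP, hG⟩
  obtain rfl : (fun i => Projectivization.mk ℂ (v i) (hv i)) = P := funext hP
  refine ⟨mk_injective_of_eval_separatingPoly (hsep v hG) hv, ?_⟩
  rw [finrank_Lspace (fun i => (hmi i).1) (fun i => (hmi i).2.trans hmd) hv fun _ => rfl,
    hfin v (left_ne_zero_of_mul (by rwa [map_mul] at hG))]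
  have hd2 : ((d : ℤ) + 1) * ((d : ℤ) + 2) / 2 = tri (d + 1) := by
    rw [← natCast_mul_add_one_div_two]
    push_cast
    ring_nf
  rw [hd2, Finset.sum_congr rfl fun i _ => natCast_mul_add_one_div_two (mi i), ← Nat.cast_sum]
  omega

end
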